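/- arXiv:2404.00248 — 3 statements merged into one kernel-verified Lean document; each statement's English description precedes it below -/
import Mathlib

section
/- Let 0 < β < 1, n ≥ 1, real coefficients a_1, …, a_{n+1}, and let F be continuous on [0,∞) and of exponential order. Let z ∈ C^n([0,∞)), with z and all of its derivatives up to order n of exponential order, solve the ordinary differential equation ∑_{k=1}^n a_k z^{(k)}(t) + a_{n+1} z(t) = F(t) for all t ≥ 0. Define y(t) = ∫_0^∞ z(s) g_β(s;t) ds and F_β(t) = ∫_0^∞ F(s) g_β(s;t) ds, and assume (D_c^β)^k y(0⁺) = z^{(k)}(0) for k = 0, 1, …, n−1. Then y solves the fractional differential equation ∑_{k=1}^n a_k (D_c^β)^k y(t) + a_{n+1} y(t) = F_β(t) for all t > 0. -/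
open MeasureTheory Real Set Filter

/-- The Wright-type density `g_β(x;t) = t^{-β} ∑_{k} (−x/t^β)^k / (k! Γ(1 − β(k+1)))`. -/
noncomputable def wrightG (β x t : ℝ) : ℝ :=
  t ^ (-β) * ∑' k : ℕ, (-x / t ^ β) ^ k / ((Nat.factorial k : ℝ) * Real.Gamma (1 - β * (k + 1)))

/-- The two-parameter Mittag-Leffler function `E_{β,α}(z) = ∑_k z^k / Γ(βk + α)`. -/
noncomputable def mittagLeffler (β α z : ℝ) : ℝ :=
  ∑' k : ℕ, z ^ k / Real.Gamma (β * k + α)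

/-- The Caputo fractional derivative of order `β ∈ (0,1)`:
`D_c^β h(t) = (1/Γ(1−β)) ∫_0^t (t−τ)^{−β} h′(τ) dτ`. -/
noncomputable def caputo (β : ℝ) (h : ℝ → ℝ) (t : ℝ) : ℝ :=
  (1 / Real.Gamma (1 - β)) * ∫ τ in (0:ℝ)..t, (t - τ) ^ (-β) * deriv h τ

/-- A function is of exponential order on `[0,∞)` if `|h(x)| ≤ C e^{a x}` there. -/
def ExpOrder (h : ℝ → ℝ) : Prop :=
  ∃ C a : ℝ, 0 < C ∧ 0 < a ∧ ∀ x : ℝ, 0 ≤ x → |h x| ≤ C * Real.exp (a * x)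

open Topology

/-- If `∂_θ k = D = ∂_v m`, then `∫₀^∞ k(θ, v) dv` changes with `θ` only through the boundary
values of `m` at `v = 0`. -/
theorem integral_Ioi_sub_eq_neg_boundary {a b : ℝ} (hab : a ≤ b) {k m D : ℝ → ℝ → ℂ} {m₀ : ℝ → ℂ}
    {B : ℝ → ℝ} (hB : IntegrableOn B (Ioi 0))
    (hk : ∀ v > 0, ∀ θ ∈ Icc a b, HasDerivAt (fun θ => k θ v) (D θ v) θ)
    (hm : ∀ θ ∈ Icc a b, ∀ v > 0, HasDerivAt (m θ) (D θ v) v)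
    (hD : ContinuousOn (Function.uncurry D) (Icc a b ×ˢ Ioi 0))
    (hDB : ∀ θ ∈ Icc a b, ∀ v > 0, ‖D θ v‖ ≤ B v)
    (hm0 : ∀ θ ∈ Icc a b, Tendsto (m θ) (𝓝[>] 0) (𝓝 (m₀ θ)))
    (hmi : ∀ θ ∈ Icc a b, Tendsto (m θ) atTop (𝓝 0))
    (hka : IntegrableOn (k a) (Ioi 0)) (hkb : IntegrableOn (k b) (Ioi 0)) :
    (∫ v in Ioi 0, k b v) - ∫ v in Ioi 0, k a v = -∫ θ in a..b, m₀ θ := by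
  have hDm : AEStronglyMeasurable (Function.uncurry D)
      ((volume.restrict (Icc a b)).prod (volume.restrict (Ioi (0:ℝ)))) := by
    rw [Measure.prod_restrict]
    exact hD.aestronglyMeasurable (measurableSet_Icc.prod measurableSet_Ioi)
  have hDi : Integrable (Function.uncurry D)
      ((volume.restrict (Icc a b)).prod (volume.restrict (Ioi (0:ℝ)))) := by
    refine Integrable.mono' (g := fun p => B p.2) (hB.comp_snd _) hDm ?_
    rw [Measure.prod_restrict]
    filter_upwards [ae_restrict_mem (measurableSet_Icc.prod measurableSet_Ioi)] with p hp
    exact hDB _ hp.1 _ hp.2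
  have hDθ : ∀ θ ∈ Icc a b, IntegrableOn (D θ) (Ioi 0) := by
    intro θ hθ
    refine Integrable.mono' hB ?_ ?_
    · refine ContinuousOn.aestronglyMeasurable ?_ measurableSet_Ioi
      exact hD.comp (f := fun v => (θ, v)) (by fun_prop) (fun v hv => ⟨hθ, hv⟩)
    · filter_upwards [ae_restrict_mem measurableSet_Ioi] with v hv using hDB _ hθ _ hv
  have h1 : ∀ v ∈ Ioi (0:ℝ), k b v - k a v = ∫ θ in Icc a b, D θ v := by
    intro v hv
    rw [integral_Icc_eq_integral_Ioc, ← intervalIntegral.integral_of_le hab]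
    refine (intervalIntegral.integral_eq_sub_of_hasDerivAt (f := fun θ => k θ v) ?_ ?_).symm
    · intro θ hθ
      rw [uIcc_of_le hab] at hθ
      exact hk v hv θ hθ
    · refine ContinuousOn.intervalIntegrable ?_
      rw [uIcc_of_le hab]
      exact hD.comp (f := fun θ => (θ, v)) (by fun_prop) (fun θ hθ => ⟨hθ, hv⟩)
  have h2 : ∀ θ ∈ Icc a b, ∫ v in Ioi 0, D θ v = -m₀ θ := by
    intro θ hθ
    have hcont : ContinuousWithinAt (Function.update (m θ) 0 (m₀ θ)) (Ici 0) 0 := by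
      rw [continuousWithinAt_update_same]
      simpa using hm0 θ hθ
    have := integral_Ioi_of_hasDerivAt_of_tendsto (f' := D θ) (m := 0) hcont ?_ (hDθ θ hθ) ?_
    · simpa using this
    · intro v hv
      refine (hm θ hθ v hv).congr_of_eventuallyEq ?_
      filter_upwards [lt_mem_nhds hv] with w hw
      rw [Function.update_of_ne hw.ne']
    · refine (hmi θ hθ).congr' ?_
      filter_upwards [eventually_gt_atTop 0] with w hw
      rw [Function.update_of_ne hw.ne']
  rw [← integral_sub hkb hka, setIntegral_congr_fun measurableSet_Ioi h1,
    ← integral_integral_swap hDi, setIntegral_congr_fun measurableSet_Icc h2, integral_neg,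
    integral_Icc_eq_integral_Ioc, intervalIntegral.integral_of_le hab]

theorem integrableOn_rpow_mul_exp_neg {p q b : ℝ} (hq : -1 < q) (hp : 0 < p) (hb : 0 < b) :
    IntegrableOn (fun x : ℝ => x ^ q * rexp (-(b * x ^ p))) (Ioi 0) := by
  simpa [neg_mul] using integrableOn_rpow_mul_exp_neg_mul_rpow hq hp hb

theorem tendsto_rpow_mul_exp_neg {p b : ℝ} (q : ℝ) (hp : 0 < p) (hb : 0 < b) :
    Tendsto (fun x : ℝ => x ^ q * rexp (-(b * x ^ p))) atTop (𝓝 0) := by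
  have h := (tendsto_rpow_mul_exp_neg_mul_atTop_nhds_zero (q / p) b hb).comp
    (tendsto_rpow_atTop hp)
  refine h.congr' ?_
  filter_upwards [eventually_gt_atTop 0] with x hx
  simp only [Function.comp, neg_mul]
  rw [← Real.rpow_mul hx.le, mul_div_cancel₀ _ hp.ne']

/-- A power `v ^ β` with `β < 1` is dominated by any linear function up to a constant. -/
theorem exists_rpow_le_mul_add {β ε : ℝ} (hβ0 : 0 < β) (hβ1 : β < 1) (hε : 0 < ε) :
    ∃ C : ℝ, ∀ v > 0, v ^ β ≤ ε * v + C := by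
  set R : ℝ := ε ^ (1 / (β - 1)) with hR
  have hR0 : 0 < R := by positivity
  have hRp : R ^ (β - 1) = ε := by
    rw [hR, ← Real.rpow_mul hε.le, one_div, inv_mul_cancel₀ (by linarith), Real.rpow_one]
  refine ⟨R ^ β, fun v hv => ?_⟩
  rcases le_total v R with h | h
  · have := Real.rpow_le_rpow hv.le h hβ0.le
    nlinarith [mul_pos hε hv]
  · have h1 := Real.rpow_le_rpow_of_nonpos hR0 h (z := β - 1) (by linarith)
    rw [hRp] at h1
    have h2 : v ^ β = v ^ (β - 1) * v := by
      rw [Real.rpow_sub_one hv.ne']; field_simp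
    rw [h2]
    have := Real.rpow_nonneg hR0.le β
    nlinarith [mul_le_mul_of_nonneg_right h1 hv.le]

theorem Real.hasDerivAt_ofReal_rpow {v : ℝ} (hv : 0 < v) (p : ℝ) :
    HasDerivAt (fun x : ℝ => ((x ^ p : ℝ) : ℂ)) ((p * v ^ (p - 1) : ℝ) : ℂ) v :=
  (Real.hasDerivAt_rpow_const (Or.inl hv.ne')).ofReal_comp

theorem HasDerivAt.cpow_const_of_real {f : ℝ → ℂ} {f' : ℂ} {x : ℝ} (hf : HasDerivAt f f' x)
    (hx : f x ∈ Complex.slitPlane) (c : ℂ) :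
    HasDerivAt (fun y => f y ^ c) (c * f x ^ (c - 1) * f') x := by
  have := ((hasDerivAt_id (f x)).cpow_const (c := c) hx).comp x hf
  simpa [Function.comp_def] using this

/-- The Laplace transform of a real power, at a complex argument in the right half-plane. -/
theorem integral_rpow_mul_cexp_neg_mul_Ioi {a : ℝ} (ha : 0 < a) {l : ℂ} (hl : 0 < l.re) :
    ∫ x in Ioi (0:ℝ), ((x ^ (a - 1) : ℝ) : ℂ) * Complex.exp (-(l * x))
      = Real.Gamma a * l ^ (-(a:ℂ)) := by
  set L : ℝ → ℂ := fun θ => 1 + θ * (l - 1) with hL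
  set δ : ℝ := min 1 l.re with hδ
  have hδ0 : 0 < δ := lt_min one_pos hl
  have hLre : ∀ θ ∈ Icc (0:ℝ) 1, δ ≤ (L θ).re := by
    intro θ hθ
    have e : (L θ).re = (1 - θ) * 1 + θ * l.re := by simp [hL]; ring
    rw [e]
    have h1 : δ ≤ 1 := min_le_left _ _
    have h2 : δ ≤ l.re := min_le_right _ _
    nlinarith [mul_le_mul_of_nonneg_left h1 (sub_nonneg.2 hθ.2), mul_le_mul_of_nonneg_left h2 hθ.1]
  have hslit : ∀ θ ∈ Icc (0:ℝ) 1, L θ ∈ Complex.slitPlane := fun θ hθ =>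
    Or.inl (hδ0.trans_le (hLre θ hθ))
  have hLc : Continuous L := by fun_prop
  obtain ⟨K, hK⟩ : ∃ K : ℝ, ∀ θ ∈ Icc (0:ℝ) 1, ‖a * (L θ) ^ ((a:ℂ) - 1)‖ ≤ K ∧
      ‖(L θ) ^ (a:ℂ)‖ ≤ K := by
    have c1 : ContinuousOn (fun θ => a * (L θ) ^ ((a:ℂ) - 1)) (Icc 0 1) :=
      continuousOn_const.mul (hLc.continuousOn.cpow_const hslit)
    have c2 : ContinuousOn (fun θ => (L θ) ^ (a:ℂ)) (Icc 0 1) :=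
      hLc.continuousOn.cpow_const hslit
    obtain ⟨K1, h1⟩ := isCompact_Icc.exists_bound_of_continuousOn c1
    obtain ⟨K2, h2⟩ := isCompact_Icc.exists_bound_of_continuousOn c2
    exact ⟨max K1 K2, fun θ hθ => ⟨(h1 θ hθ).trans (le_max_left _ _),
      (h2 θ hθ).trans (le_max_right _ _)⟩⟩
  have hexp : ∀ θ ∈ Icc (0:ℝ) 1, ∀ v > (0:ℝ), ‖Complex.exp (-(L θ * v))‖ ≤ rexp (-(δ * v)) := by
    intro θ hθ v hv
    rw [Complex.norm_exp]
    simp only [Complex.neg_re, Complex.re_mul_ofReal]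
    have := mul_le_mul_of_nonneg_right (hLre θ hθ) hv.le
    gcongr
  have hint : ∀ q : ℝ, -1 < q → IntegrableOn (fun v : ℝ => v ^ q * rexp (-(δ * v))) (Ioi 0) := by
    intro q hq
    simpa using integrableOn_rpow_mul_exp_neg hq one_pos hδ0
  have hlim : ∀ q : ℝ, Tendsto (fun v : ℝ => v ^ q * rexp (-(δ * v))) atTop (𝓝 0) := by
    intro q
    simpa using tendsto_rpow_mul_exp_neg q one_pos hδ0
  set k : ℝ → ℝ → ℂ := fun θ v =>
    (L θ) ^ (a:ℂ) * (((v ^ (a - 1) : ℝ) : ℂ) * Complex.exp (-(L θ * v))) with hkdef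
  set D : ℝ → ℝ → ℂ := fun θ v =>
    (l - 1) * ((a * (L θ) ^ ((a:ℂ) - 1)) * ((v ^ (a - 1) : ℝ) : ℂ)
      - (L θ) ^ (a:ℂ) * ((v ^ a : ℝ) : ℂ)) * Complex.exp (-(L θ * v)) with hDdef
  set m : ℝ → ℝ → ℂ := fun θ v =>
    (l - 1) * (L θ) ^ ((a:ℂ) - 1) * (((v ^ a : ℝ) : ℂ) * Complex.exp (-(L θ * v))) with hmdef
  have hLd : ∀ θ, HasDerivAt L (l - 1) θ := by
    intro θ
    have := ((Complex.ofRealCLM.hasDerivAt (x := θ)).mul_const (l - 1)).const_add 1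
    simpa [hL] using this
  have hvp : ∀ v > (0:ℝ), ((v ^ a : ℝ) : ℂ) = ((v ^ (a - 1) : ℝ) : ℂ) * v := by
    intro v hv
    rw [← Complex.ofReal_mul, Real.rpow_sub_one hv.ne']
    congr 1; field_simp
  have hLpow : ∀ θ ∈ Icc (0:ℝ) 1, (L θ) ^ (a:ℂ) = (L θ) ^ ((a:ℂ) - 1) * L θ := by
    intro θ hθ
    have h0 := Complex.slitPlane_ne_zero (hslit θ hθ)
    rw [Complex.cpow_sub _ _ h0, Complex.cpow_one]; field_simp
  have hk_int : ∀ θ ∈ Icc (0:ℝ) 1, IntegrableOn (k θ) (Ioi 0) := by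
    intro θ hθ
    refine Integrable.const_mul ?_ _
    refine Integrable.mono' (hint (a - 1) (by linarith)) ?_ ?_
    · refine ContinuousOn.aestronglyMeasurable ?_ measurableSet_Ioi
      intro v hv
      refine ContinuousAt.continuousWithinAt ?_
      exact (Real.hasDerivAt_ofReal_rpow hv _).continuousAt.mul (by fun_prop)
    · filter_upwards [ae_restrict_mem measurableSet_Ioi] with v hv
      rw [norm_mul, Complex.norm_real, Real.norm_of_nonneg (Real.rpow_nonneg (le_of_lt hv) _)]
      exact mul_le_mul_of_nonneg_left (hexp θ hθ v hv) (Real.rpow_nonneg (le_of_lt hv) _)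
  have key := integral_Ioi_sub_eq_neg_boundary (a := 0) (b := 1) zero_le_one
    (k := k) (m := m) (D := D) (m₀ := fun _ => 0)
    (B := fun v => ‖l - 1‖ * K * (v ^ (a - 1) * rexp (-(δ * v)))
      + ‖l - 1‖ * K * (v ^ a * rexp (-(δ * v))))
    (((hint (a - 1) (by linarith)).const_mul _).add ((hint a (by linarith)).const_mul _))
    ?_ ?_ ?_ ?_ ?_ ?_ (hk_int 0 (by simp)) (hk_int 1 (by simp))
  · have e0 : ∫ v in Ioi (0:ℝ), k 0 v = Real.Gamma a := by
      have := Complex.integral_cpow_mul_exp_neg_mul_Ioi (a := a) (r := 1) (by simpa) one_pos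
      simp only [Complex.ofReal_one, one_mul, div_one, Complex.one_cpow] at this
      rw [← Complex.Gamma_ofReal, ← this]
      refine setIntegral_congr_fun measurableSet_Ioi fun v hv => ?_
      simp only [hkdef, hL, Complex.ofReal_zero, zero_mul, add_zero, Complex.one_cpow, one_mul]
      rw [Complex.ofReal_cpow (le_of_lt hv)]
      push_cast; rfl
    have e1 : ∫ v in Ioi (0:ℝ), k 1 v = l ^ (a:ℂ) *
        ∫ x in Ioi (0:ℝ), ((x ^ (a - 1) : ℝ) : ℂ) * Complex.exp (-(l * x)) := by
      rw [← integral_const_mul]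
      simp [hkdef, hL]
    rw [e0, e1] at key
    simp only [intervalIntegral.integral_zero, neg_zero] at key
    have hl0 : l ≠ 0 := fun h => by simp [h] at hl
    have hla : l ^ (a:ℂ) ≠ 0 := by simp [Complex.cpow_eq_zero_iff, hl0]
    rw [Complex.cpow_neg, ← sub_eq_zero.1 key]
    field_simp
  · intro v hv θ hθ
    have h1 := (hLd θ).cpow_const_of_real (hslit θ hθ) a
    have h2 := (((hLd θ).mul_const (v:ℂ)).neg.cexp).const_mul ((v ^ (a - 1) : ℝ) : ℂ)
    refine (h1.mul h2).congr_deriv ?_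
    simp only [hDdef, Pi.neg_apply]
    rw [hvp v hv]
    ring
  · intro θ hθ v hv
    have h1 := Real.hasDerivAt_ofReal_rpow hv a
    have h2 := (((Complex.ofRealCLM.hasDerivAt (x := v)).const_mul (L θ)).neg.cexp)
    refine ((h1.mul h2).const_mul ((l - 1) * (L θ) ^ ((a:ℂ) - 1))).congr_deriv ?_
    simp only [hDdef, Complex.ofRealCLM_apply, Complex.ofReal_one, Pi.neg_apply]
    rw [hLpow θ hθ]
    push_cast
    ring
  · have hc : ∀ c : ℂ, ContinuousOn (fun p : ℝ × ℝ => (L p.1) ^ c) (Icc 0 1 ×ˢ Ioi 0) :=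
      fun c => (hLc.comp continuous_fst).continuousOn.cpow_const (fun p hp => hslit _ hp.1)
    have hr : ∀ q : ℝ, ContinuousOn (fun p : ℝ × ℝ => ((p.2 ^ q : ℝ) : ℂ)) (Icc 0 1 ×ˢ Ioi 0) :=
      fun q => Complex.continuous_ofReal.comp_continuousOn
        (continuous_snd.continuousOn.rpow_const fun p hp => Or.inl (ne_of_gt hp.2))
    exact (continuousOn_const.mul (((continuousOn_const.mul (hc _)).mul (hr _)).sub
      ((hc _).mul (hr _)))).mul (by fun_prop)
  · intro θ hθ v hv
    simp only [hDdef]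
    have hv1 := Real.rpow_nonneg hv.le (a - 1)
    have hv2 := Real.rpow_nonneg hv.le a
    obtain ⟨hK1, hK2⟩ := hK θ hθ
    calc _ ≤ ‖l - 1‖ * (K * v ^ (a - 1) + K * v ^ a) * rexp (-(δ * v)) := by
          rw [norm_mul, norm_mul]
          refine mul_le_mul (mul_le_mul_of_nonneg_left ?_ (norm_nonneg _)) (hexp θ hθ v hv)
            (norm_nonneg _) ?_
          · refine (norm_sub_le _ _).trans (add_le_add ?_ ?_)
            · rw [norm_mul, Complex.norm_real, Real.norm_of_nonneg hv1]
              exact mul_le_mul_of_nonneg_right hK1 hv1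
            · rw [norm_mul, Complex.norm_real, Real.norm_of_nonneg hv2]
              exact mul_le_mul_of_nonneg_right hK2 hv2
          · have : 0 ≤ K := (norm_nonneg _).trans hK1
            positivity
      _ = _ := by ring
  · intro θ hθ
    have : Tendsto (m θ) (𝓝 0) (𝓝 (m θ 0)) := by
      refine ContinuousAt.tendsto ?_
      have : ContinuousAt (fun v : ℝ => ((v ^ a : ℝ) : ℂ)) 0 :=
        Complex.continuous_ofReal.continuousAt.comp
          (Real.continuousAt_rpow_const _ _ (Or.inr ha.le))
      exact continuousAt_const.mul (this.mul (by fun_prop))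
    have h0 : m θ 0 = 0 := by simp [hmdef, Real.zero_rpow ha.ne']
    rw [h0] at this
    exact this.mono_left nhdsWithin_le_nhds
  · intro θ hθ
    have h := (hlim a).const_mul ‖(l - 1) * (L θ) ^ ((a:ℂ) - 1)‖
    rw [mul_zero] at h
    refine squeeze_zero_norm' ?_ h
    filter_upwards [eventually_gt_atTop 0] with v hv
    simp only [hmdef]
    rw [norm_mul]
    refine mul_le_mul_of_nonneg_left ?_ (norm_nonneg _)
    rw [norm_mul, Complex.norm_real, Real.norm_of_nonneg (Real.rpow_nonneg hv.le _)]
    exact mul_le_mul_of_nonneg_left (hexp θ hθ v hv) (Real.rpow_nonneg hv.le _)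

theorem cos_mul_half_pi_pos {β : ℝ} (hβ0 : 0 < β) (hβ1 : β < 1) : 0 < Real.cos (β * (π / 2)) :=
  Real.cos_pos_of_mem_Ioo ⟨by nlinarith [Real.pi_pos], by nlinarith [Real.pi_pos]⟩

theorem cos_mul_norm_rpow_le_re_cpow {β : ℝ} (hβ0 : 0 < β) (hβ1 : β < 1) {l : ℂ}
    (hl : 0 ≤ l.re) : Real.cos (β * (π / 2)) * ‖l‖ ^ β ≤ (l ^ (β : ℂ)).re := by
  rw [Complex.cpow_ofReal_re, mul_comm]
  refine mul_le_mul_of_nonneg_left ?_ (by positivity)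
  rw [← Real.cos_abs (l.arg * β), abs_mul, abs_of_pos hβ0, mul_comm |l.arg|]
  have h := Complex.abs_arg_le_pi_div_two_iff.2 hl
  refine Real.cos_le_cos_of_nonneg_of_le_pi (by positivity) ?_ (by gcongr)
  nlinarith [Real.pi_pos]

/-- The integrand `exp(λt - sλ^β)` of the inverse Laplace transform of `exp(-sλ^β)`, at the point
`λ = c + iv` of a vertical line. -/
noncomputable def lineIntegrand (β s t c v : ℝ) : ℂ :=
  Complex.exp ((c + v * Complex.I) * t - s * (c + v * Complex.I : ℂ) ^ (β : ℂ))

section Line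

variable {β s t c v : ℝ}

theorem rpow_add_rpow_div_two_le (hβ0 : 0 < β) (hc : 0 ≤ c) (hv : 0 ≤ v) :
    (c ^ β + v ^ β) / 2 ≤ ‖(c + v * Complex.I : ℂ)‖ ^ β := by
  have h1 : c ≤ ‖(c + v * Complex.I : ℂ)‖ := by
    simpa using Complex.re_le_norm (c + v * Complex.I : ℂ)
  have h2 : v ≤ ‖(c + v * Complex.I : ℂ)‖ := by
    simpa using Complex.im_le_norm (c + v * Complex.I : ℂ)
  have := Real.rpow_le_rpow hc h1 hβ0.le
  have := Real.rpow_le_rpow hv h2 hβ0.le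
  linarith

theorem norm_lineIntegrand_le (hβ0 : 0 < β) (hβ1 : β < 1) (hs : 0 < s) (hc : 0 ≤ c)
    (hv : 0 ≤ v) :
    ‖lineIntegrand β s t c v‖ ≤ rexp (c * t - s * Real.cos (β * (π / 2)) / 2 * c ^ β) *
      rexp (-(s * Real.cos (β * (π / 2)) / 2 * v ^ β)) := by
  rw [lineIntegrand, Complex.norm_exp, ← Real.exp_add]
  refine Real.exp_le_exp.2 ?_
  have hre : ((c + v * Complex.I : ℂ) * t).re = c * t := by simp
  rw [Complex.sub_re, hre, Complex.re_ofReal_mul]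
  have h1 := cos_mul_norm_rpow_le_re_cpow hβ0 hβ1 (l := (c + v * Complex.I : ℂ)) (by simpa)
  have h2 := rpow_add_rpow_div_two_le hβ0 hc hv
  have h3 := mul_le_mul_of_nonneg_left h2 (mul_pos hs (cos_mul_half_pi_pos hβ0 hβ1)).le
  have h4 := mul_le_mul_of_nonneg_left h1 hs.le
  linarith

theorem line_mem_slitPlane (hv : 0 < v) : (c + v * Complex.I : ℂ) ∈ Complex.slitPlane :=
  Or.inr (by simpa using hv.ne')

theorem norm_line_cpow_le (hβ1 : β < 1) (hv : 0 < v) :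
    ‖(c + v * Complex.I : ℂ) ^ ((β : ℂ) - 1)‖ ≤ v ^ (β - 1) := by
  have h2 : v ≤ ‖(c + v * Complex.I : ℂ)‖ := by
    simpa using Complex.im_le_norm (c + v * Complex.I : ℂ)
  rw [show ((β : ℂ) - 1) = ((β - 1 : ℝ) : ℂ) by push_cast; rfl, Complex.norm_cpow_real]
  exact Real.rpow_le_rpow_of_nonpos hv h2 (by linarith)

/-- The derivative of `exp(λt - sλ^β)` at `λ = c + iv`. -/
noncomputable def lineIntegrandDeriv (β s t c v : ℝ) : ℂ :=
  (t - s * β * (c + v * Complex.I : ℂ) ^ ((β : ℂ) - 1)) * lineIntegrand β s t c v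

theorem hasDerivAt_lineIntegrand_left (hv : 0 < v) :
    HasDerivAt (fun c => lineIntegrand β s t c v) (lineIntegrandDeriv β s t c v) c := by
  have h0 : HasDerivAt (fun c : ℝ => (c + v * Complex.I : ℂ)) 1 c := by
    simpa using (Complex.ofRealCLM.hasDerivAt (x := c)).add_const (v * Complex.I)
  have h1 := h0.cpow_const_of_real (line_mem_slitPlane hv) β
  refine (((h0.mul_const (t:ℂ)).sub (h1.const_mul (s:ℂ))).cexp).congr_deriv ?_
  simp only [lineIntegrandDeriv, lineIntegrand, Pi.sub_apply]
  ring

theorem hasDerivAt_lineIntegrand_right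
    (hcv : (c + v * Complex.I : ℂ) ∈ Complex.slitPlane) :
    HasDerivAt (fun v => lineIntegrand β s t c v)
      (Complex.I * lineIntegrandDeriv β s t c v) v := by
  have h0 : HasDerivAt (fun v : ℝ => (c + v * Complex.I : ℂ)) Complex.I v := by
    simpa using ((Complex.ofRealCLM.hasDerivAt (x := v)).mul_const Complex.I).const_add (c:ℂ)
  have h1 := h0.cpow_const_of_real hcv β
  refine (((h0.mul_const (t:ℂ)).sub (h1.const_mul (s:ℂ))).cexp).congr_deriv ?_
  simp only [lineIntegrandDeriv, lineIntegrand, Pi.sub_apply]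
  ring

theorem continuousOn_line_cpow (p : ℂ) :
    ContinuousOn (fun q : ℝ × ℝ => (q.1 + q.2 * Complex.I : ℂ) ^ p) (univ ×ˢ Ioi 0) :=
  ContinuousOn.cpow_const (by fun_prop) fun _ hq => line_mem_slitPlane hq.2

theorem continuousOn_lineIntegrand :
    ContinuousOn (fun q : ℝ × ℝ => lineIntegrand β s t q.1 q.2) (univ ×ˢ Ioi 0) :=
  Complex.continuous_exp.comp_continuousOn (ContinuousOn.sub (by fun_prop)
    (continuousOn_const.mul (continuousOn_line_cpow _)))

theorem continuousOn_lineIntegrandDeriv :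
    ContinuousOn (fun q : ℝ × ℝ => lineIntegrandDeriv β s t q.1 q.2) (univ ×ˢ Ioi 0) :=
  (continuousOn_const.sub (continuousOn_const.mul (continuousOn_line_cpow _))).mul
    continuousOn_lineIntegrand

theorem continuous_lineIntegrand_right (hβ0 : 0 < β) (hc : 0 ≤ c) :
    ContinuousWithinAt (lineIntegrand β s t c) (Ici 0) 0 := by
  refine ContinuousAt.continuousWithinAt ?_
  refine ContinuousAt.cexp (ContinuousAt.sub (by fun_prop) (continuousAt_const.mul ?_))
  refine ContinuousAt.comp (f := fun v : ℝ => (c + v * Complex.I : ℂ))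
    (g := fun z : ℂ => z ^ (β : ℂ)) ?_ (by fun_prop)
  exact Complex.continuousAt_cpow_const_of_re_pos (Or.inl (by simpa)) (by simpa)

theorem integrableOn_exp_neg_rpow (hβ0 : 0 < β) {b : ℝ} (hb : 0 < b) :
    IntegrableOn (fun v : ℝ => rexp (-(b * v ^ β))) (Ioi 0) := by
  simpa using integrableOn_rpow_mul_exp_neg (q := 0) (by norm_num) hβ0 hb

theorem tendsto_exp_neg_rpow (hβ0 : 0 < β) {b : ℝ} (hb : 0 < b) :
    Tendsto (fun v : ℝ => rexp (-(b * v ^ β))) atTop (𝓝 0) := by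
  simpa using tendsto_rpow_mul_exp_neg 0 hβ0 hb

theorem tendsto_lineIntegrand_atTop (hβ0 : 0 < β) (hβ1 : β < 1) (hs : 0 < s) (hc : 0 ≤ c) :
    Tendsto (lineIntegrand β s t c) atTop (𝓝 0) := by
  have hb : 0 < s * Real.cos (β * (π / 2)) / 2 := by
    have := cos_mul_half_pi_pos hβ0 hβ1; positivity
  have h := (tendsto_exp_neg_rpow hβ0 hb).const_mul
    (rexp (c * t - s * Real.cos (β * (π / 2)) / 2 * c ^ β))
  rw [mul_zero] at h
  refine squeeze_zero_norm' ?_ h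
  filter_upwards [eventually_gt_atTop 0] with v hv
  exact norm_lineIntegrand_le hβ0 hβ1 hs hc hv.le

theorem aestronglyMeasurable_line {f : ℝ × ℝ → ℂ} (hf : ContinuousOn f (univ ×ˢ Ioi 0)) :
    AEStronglyMeasurable (fun v => f (c, v)) (volume.restrict (Ioi 0)) := by
  refine ContinuousOn.aestronglyMeasurable ?_ measurableSet_Ioi
  exact hf.comp (f := fun v => (c, v)) (by fun_prop) (fun v hv => ⟨mem_univ _, hv⟩)

theorem integrableOn_lineIntegrand (hβ0 : 0 < β) (hβ1 : β < 1) (hs : 0 < s) (hc : 0 ≤ c) :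
    IntegrableOn (lineIntegrand β s t c) (Ioi 0) := by
  have hb : 0 < s * Real.cos (β * (π / 2)) / 2 := by
    have := cos_mul_half_pi_pos hβ0 hβ1; positivity
  refine Integrable.mono' ((integrableOn_exp_neg_rpow hβ0 hb).const_mul
    (rexp (c * t - s * Real.cos (β * (π / 2)) / 2 * c ^ β)))
    (aestronglyMeasurable_line continuousOn_lineIntegrand) ?_
  filter_upwards [ae_restrict_mem measurableSet_Ioi] with v hv
  exact norm_lineIntegrand_le hβ0 hβ1 hs hc (le_of_lt hv)

theorem norm_integral_lineIntegrand_le (hβ0 : 0 < β) (hβ1 : β < 1) (hs : 0 < s) (hc : 0 ≤ c) :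
    ‖∫ v in Ioi 0, lineIntegrand β s t c v‖ ≤
      rexp (c * t - s * Real.cos (β * (π / 2)) / 2 * c ^ β) *
        ∫ v in Ioi 0, rexp (-(s * Real.cos (β * (π / 2)) / 2 * v ^ β)) := by
  have hb : 0 < s * Real.cos (β * (π / 2)) / 2 := by
    have := cos_mul_half_pi_pos hβ0 hβ1; positivity
  rw [← integral_const_mul]
  refine norm_integral_le_of_norm_le ((integrableOn_exp_neg_rpow hβ0 hb).const_mul _) ?_
  filter_upwards [ae_restrict_mem measurableSet_Ioi] with v hv
  exact norm_lineIntegrand_le hβ0 hβ1 hs hc (le_of_lt hv)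

theorem norm_lineIntegrandDeriv_le (hβ0 : 0 < β) (hβ1 : β < 1) (hs : 0 < s) {C : ℝ}
    (hc : c ∈ Icc 0 C) (hv : 0 < v) :
    ‖lineIntegrandDeriv β s t c v‖ ≤ rexp (C * |t|) *
      (|t| * rexp (-(s * Real.cos (β * (π / 2)) / 2 * v ^ β)) +
        s * β * (v ^ (β - 1) * rexp (-(s * Real.cos (β * (π / 2)) / 2 * v ^ β)))) := by
  have hb : 0 < s * Real.cos (β * (π / 2)) / 2 := by
    have := cos_mul_half_pi_pos hβ0 hβ1; positivity
  have h1 : ‖(t - s * β * (c + v * Complex.I : ℂ) ^ ((β : ℂ) - 1))‖ ≤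
      |t| + s * β * v ^ (β - 1) := by
    refine (norm_sub_le _ _).trans ?_
    rw [norm_mul, norm_mul, Complex.norm_real, Complex.norm_real, Complex.norm_real,
      Real.norm_of_nonneg hs.le, Real.norm_of_nonneg hβ0.le, Real.norm_eq_abs]
    have := norm_line_cpow_le (c := c) hβ1 hv
    gcongr
  have h2 : rexp (c * t - s * Real.cos (β * (π / 2)) / 2 * c ^ β) ≤ rexp (C * |t|) := by
    refine Real.exp_le_exp.2 ?_
    have : 0 ≤ s * Real.cos (β * (π / 2)) / 2 * c ^ β :=
      mul_nonneg hb.le (Real.rpow_nonneg hc.1 _)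
    have : c * t ≤ C * |t| :=
      (mul_le_mul_of_nonneg_left (le_abs_self t) hc.1).trans
        (mul_le_mul_of_nonneg_right hc.2 (abs_nonneg t))
    linarith
  have h3 := norm_lineIntegrand_le (t := t) hβ0 hβ1 hs hc.1 hv.le
  rw [lineIntegrandDeriv, norm_mul]
  have hv' := Real.rpow_nonneg hv.le (β - 1)
  calc _ ≤ (|t| + s * β * v ^ (β - 1)) *
        (rexp (C * |t|) * rexp (-(s * Real.cos (β * (π / 2)) / 2 * v ^ β))) := by
        refine mul_le_mul h1 (h3.trans ?_) (norm_nonneg _) (by positivity)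
        gcongr
    _ = _ := by ring

theorem lineIntegrand_zero_right (hc : 0 ≤ c) :
    lineIntegrand β s t c 0 = ((rexp (c * t - s * c ^ β) : ℝ) : ℂ) := by
  simp [lineIntegrand, Complex.ofReal_cpow hc]

theorem integrableOn_lineIntegrandDeriv_bound (hβ0 : 0 < β) (hβ1 : β < 1) (hs : 0 < s) (C : ℝ) :
    IntegrableOn (fun v => rexp (C * |t|) *
      (|t| * rexp (-(s * Real.cos (β * (π / 2)) / 2 * v ^ β)) +
        s * β * (v ^ (β - 1) * rexp (-(s * Real.cos (β * (π / 2)) / 2 * v ^ β))))) (Ioi 0) := by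
  have hb : 0 < s * Real.cos (β * (π / 2)) / 2 := by
    have := cos_mul_half_pi_pos hβ0 hβ1; positivity
  exact (((integrableOn_exp_neg_rpow hβ0 hb).const_mul _).add
    ((integrableOn_rpow_mul_exp_neg (by linarith) hβ0 hb).const_mul _)).const_mul _

/-- The real part of the inverse Laplace integral does not depend on the vertical line. -/
theorem re_integral_lineIntegrand_eq (hβ0 : 0 < β) (hβ1 : β < 1) (hs : 0 < s) (hc : 0 ≤ c) :
    (∫ v in Ioi 0, lineIntegrand β s t c v).re = (∫ v in Ioi 0, lineIntegrand β s t 0 v).re := by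
  have key := integral_Ioi_sub_eq_neg_boundary hc (k := lineIntegrand β s t)
    (m := fun c v => -Complex.I * lineIntegrand β s t c v) (D := lineIntegrandDeriv β s t)
    (m₀ := fun c => -Complex.I * lineIntegrand β s t c 0)
    (integrableOn_lineIntegrandDeriv_bound (t := t) hβ0 hβ1 hs c)
    (fun v hv θ _ => hasDerivAt_lineIntegrand_left hv)
    (fun θ _ v hv => by
      refine ((hasDerivAt_lineIntegrand_right (line_mem_slitPlane hv)).const_mul
        (-Complex.I)).congr_deriv ?_
      rw [← mul_assoc]; simp)
    (continuousOn_lineIntegrandDeriv.mono (prod_mono (subset_univ _) subset_rfl))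
    (fun θ hθ v hv => norm_lineIntegrandDeriv_le hβ0 hβ1 hs hθ hv)
    (fun θ hθ => Tendsto.const_mul _
      ((continuous_lineIntegrand_right hβ0 hθ.1).tendsto.mono_left
        (nhdsWithin_mono _ Ioi_subset_Ici_self)))
    (fun θ hθ => by
      simpa using (tendsto_lineIntegrand_atTop (t := t) hβ0 hβ1 hs hθ.1).const_mul (-Complex.I))
    (integrableOn_lineIntegrand hβ0 hβ1 hs le_rfl)
    (integrableOn_lineIntegrand hβ0 hβ1 hs hc)
  have h0 : ∫ θ in (0:ℝ)..c, -Complex.I * lineIntegrand β s t θ 0 =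
      -Complex.I * ((∫ θ in (0:ℝ)..c, rexp (θ * t - s * θ ^ β) : ℝ) : ℂ) := by
    rw [intervalIntegral.integral_const_mul, ← intervalIntegral.integral_ofReal]
    congr 1
    refine intervalIntegral.integral_congr fun θ hθ => ?_
    rw [uIcc_of_le hc] at hθ
    exact lineIntegrand_zero_right hθ.1
  rw [h0] at key
  have := congrArg Complex.re key
  rw [Complex.sub_re] at this
  simpa [sub_eq_zero] using this

/-- Integration by parts along a vertical line. -/
theorem mul_re_integral_lineIntegrand (hβ0 : 0 < β) (hβ1 : β < 1) (hs : 0 < s) (hc : 0 < c) :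
    t * (∫ v in Ioi 0, lineIntegrand β s t c v).re = s * β *
      (∫ v : ℝ in Ioi 0, (c + v * Complex.I : ℂ) ^ ((β : ℂ) - 1) * lineIntegrand β s t c v).re := by
  have hDi : IntegrableOn (lineIntegrandDeriv β s t c) (Ioi 0) := by
    refine Integrable.mono' (integrableOn_lineIntegrandDeriv_bound (t := t) hβ0 hβ1 hs c)
      (aestronglyMeasurable_line continuousOn_lineIntegrandDeriv) ?_
    filter_upwards [ae_restrict_mem measurableSet_Ioi] with v hv
    exact norm_lineIntegrandDeriv_le hβ0 hβ1 hs ⟨hc.le, le_rfl⟩ hv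
  have h := integral_Ioi_of_hasDerivAt_of_tendsto (continuous_lineIntegrand_right hβ0 hc.le)
    (fun v hv => hasDerivAt_lineIntegrand_right (line_mem_slitPlane hv)) (hDi.const_mul Complex.I)
    (tendsto_lineIntegrand_atTop (t := t) hβ0 hβ1 hs hc.le)
  rw [integral_const_mul, lineIntegrand_zero_right hc.le] at h
  have h1 := congrArg Complex.im h
  simp only [Complex.I_mul_im, Complex.sub_im, Complex.zero_im, Complex.ofReal_im,
    sub_zero] at h1
  have hf := (integrableOn_lineIntegrand (t := t) hβ0 hβ1 hs hc.le).const_mul (t:ℂ)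
  have e : ∀ v : ℝ, (c + v * Complex.I : ℂ) ^ ((β : ℂ) - 1) * lineIntegrand β s t c v =
      ((s * β : ℝ) : ℂ)⁻¹ * (t * lineIntegrand β s t c v - lineIntegrandDeriv β s t c v) := by
    intro v
    have : ((s * β : ℝ) : ℂ) ≠ 0 := by exact_mod_cast (mul_pos hs hβ0).ne'
    rw [eq_inv_mul_iff_mul_eq₀ this, lineIntegrandDeriv]
    push_cast; ring
  simp only [e]
  rw [integral_const_mul, integral_sub hf hDi, integral_const_mul, ← Complex.ofReal_inv,
    Complex.re_ofReal_mul, Complex.sub_re, Complex.re_ofReal_mul, h1, sub_zero]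
  have := (mul_pos hs hβ0).ne'
  field_simp

end Line

/-- The integrand `exp(λt - sλ^β)` on the ray `λ = v e^{iφ}`. -/
noncomputable def rayIntegrand (β s t φ v : ℝ) : ℂ :=
  Complex.exp (v * t * Complex.exp (φ * Complex.I) -
    s * ((v ^ β : ℝ) : ℂ) * Complex.exp (β * φ * Complex.I))

section Ray

variable {β s t : ℝ}

theorem norm_rayIntegrand (φ v : ℝ) :
    ‖rayIntegrand β s t φ v‖ = rexp (v * t * Real.cos φ - s * v ^ β * Real.cos (β * φ)) := by
  rw [rayIntegrand, Complex.norm_exp, ← Complex.ofReal_mul, ← Complex.ofReal_mul,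
    ← Complex.ofReal_mul, Complex.sub_re, Complex.re_ofReal_mul, Complex.re_ofReal_mul,
    Complex.exp_ofReal_mul_I_re, Complex.exp_ofReal_mul_I_re]

theorem exists_norm_rayIntegrand_le (hβ0 : 0 < β) (hβ1 : β < 1) (hs : 0 < s) (ht : 0 < t) :
    ∃ C b : ℝ, 0 < b ∧ ∀ φ ∈ Icc (π / 2) π, ∀ v > 0,
      ‖rayIntegrand β s t φ v‖ ≤ C * rexp (-(b * v ^ β)) := by
  have hπ := Real.pi_pos
  set φ₀ : ℝ := π / (1 + β) with hφ₀
  have hφβ : β * φ₀ = π - φ₀ := by rw [hφ₀]; field_simp; ring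
  have hφ₀1 : π / 2 < φ₀ := by rw [hφ₀]; gcongr; linarith
  have hφ₀2 : φ₀ < π := by
    rw [hφ₀, div_lt_iff₀ (by linarith)]; nlinarith
  set κ : ℝ := Real.cos (β * φ₀) with hκ
  have hκ0 : 0 < κ := Real.cos_pos_of_mem_Ioo ⟨by linarith, by linarith⟩
  have hκ' : Real.cos φ₀ = -κ := by rw [hκ, hφβ, Real.cos_pi_sub, neg_neg]
  obtain ⟨C, hC⟩ := exists_rpow_le_mul_add hβ0 hβ1 (ε := t * κ / (s + s * κ)) (by positivity)
  refine ⟨max 1 (rexp ((s + s * κ) * C)), s * κ, by positivity, fun φ hφ v hv => ?_⟩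
  have hvβ : 0 ≤ v ^ β := Real.rpow_nonneg hv.le _
  rw [norm_rayIntegrand]
  rcases le_total φ φ₀ with h | h
  · have h1 : Real.cos φ ≤ 0 := Real.cos_nonpos_of_pi_div_two_le_of_le hφ.1 (by linarith [hφ.2])
    have h2 : κ ≤ Real.cos (β * φ) := by
      refine Real.cos_le_cos_of_nonneg_of_le_pi ?_ (by linarith) (by gcongr)
      exact mul_nonneg hβ0.le (by linarith [hφ.1])
    have h3 : rexp (v * t * Real.cos φ - s * v ^ β * Real.cos (β * φ)) ≤
        rexp (-(s * κ * v ^ β)) := by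
      refine Real.exp_le_exp.2 ?_
      nlinarith [mul_nonneg (mul_pos hv ht).le (neg_nonneg.2 h1),
        mul_le_mul_of_nonneg_left h2 (mul_nonneg hs.le hvβ)]
    exact h3.trans (le_mul_of_one_le_left (Real.exp_pos _).le (le_max_left _ _))
  · have h1 : Real.cos φ ≤ -κ := by
      rw [← hκ']
      exact Real.cos_le_cos_of_nonneg_of_le_pi (by linarith) hφ.2 h
    have h2 := Real.neg_one_le_cos (β * φ)
    have h4 := mul_le_mul_of_nonneg_left (hC v hv) (show 0 ≤ s + s * κ by positivity)
    have h5 : (s + s * κ) * (t * κ / (s + s * κ) * v + C) = t * κ * v + (s + s * κ) * C := by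
      field_simp
    rw [h5] at h4
    have h3 : rexp (v * t * Real.cos φ - s * v ^ β * Real.cos (β * φ)) ≤
        rexp ((s + s * κ) * C) * rexp (-(s * κ * v ^ β)) := by
      rw [← Real.exp_add]
      refine Real.exp_le_exp.2 ?_
      nlinarith [mul_le_mul_of_nonneg_left h1 (mul_pos hv ht).le,
        mul_le_mul_of_nonneg_left h2 (mul_nonneg hs.le hvβ)]
    exact h3.trans (mul_le_mul_of_nonneg_right (le_max_right _ _) (Real.exp_pos _).le)

theorem hasDerivAt_cexp_mul_ofReal_mul_I (b : ℝ) (φ : ℝ) :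
    HasDerivAt (fun φ : ℝ => Complex.exp (b * φ * Complex.I))
      (b * Complex.I * Complex.exp (b * φ * Complex.I)) φ := by
  have := (((Complex.ofRealCLM.hasDerivAt (x := φ)).const_mul (b:ℂ)).mul_const Complex.I).cexp
  refine this.congr_deriv ?_
  simp only [Complex.ofRealCLM_apply, Complex.ofReal_one]
  ring

theorem hasDerivAt_rayIntegrand_left (φ v : ℝ) :
    HasDerivAt (fun φ => rayIntegrand β s t φ v)
      (Complex.I * (v * t * Complex.exp (φ * Complex.I) -
        s * β * ((v ^ β : ℝ) : ℂ) * Complex.exp (β * φ * Complex.I)) *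
        rayIntegrand β s t φ v) φ := by
  have h1 := hasDerivAt_cexp_mul_ofReal_mul_I 1 φ
  simp only [Complex.ofReal_one, one_mul] at h1
  have h2 := hasDerivAt_cexp_mul_ofReal_mul_I β φ
  refine ((h1.const_mul (v * t : ℂ)).sub
    (h2.const_mul (s * ((v ^ β : ℝ) : ℂ)))).cexp.congr_deriv ?_
  simp only [rayIntegrand, Pi.sub_apply]
  ring

theorem hasDerivAt_rayIntegrand_right (φ : ℝ) {v : ℝ} (hv : 0 < v) :
    HasDerivAt (rayIntegrand β s t φ)
      ((t * Complex.exp (φ * Complex.I) -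
        s * β * ((v ^ (β - 1) : ℝ) : ℂ) * Complex.exp (β * φ * Complex.I)) *
        rayIntegrand β s t φ v) v := by
  have h1 := ((Complex.ofRealCLM.hasDerivAt (x := v)).mul_const (t:ℂ)).mul_const
    (Complex.exp (φ * Complex.I))
  have h2 := ((Real.hasDerivAt_ofReal_rpow hv β).const_mul (s:ℂ)).mul_const
    (Complex.exp (β * φ * Complex.I))
  refine (h1.sub h2).cexp.congr_deriv ?_
  simp only [rayIntegrand, Pi.sub_apply, Complex.ofRealCLM_apply, Complex.ofReal_one]
  push_cast
  ring

theorem continuousOn_ofReal_rpow_snd (S : Set ℝ) (q : ℝ) :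
    ContinuousOn (fun p : ℝ × ℝ => ((p.2 ^ q : ℝ) : ℂ)) (S ×ˢ Ioi 0) :=
  Complex.continuous_ofReal.comp_continuousOn
    (continuous_snd.continuousOn.rpow_const fun _ hp => Or.inl (ne_of_gt hp.2))

theorem continuousOn_rayIntegrand (S : Set ℝ) :
    ContinuousOn (fun p : ℝ × ℝ => rayIntegrand β s t p.1 p.2) (S ×ˢ Ioi 0) :=
  Complex.continuous_exp.comp_continuousOn (ContinuousOn.sub (by fun_prop)
    ((continuousOn_const.mul (continuousOn_ofReal_rpow_snd S β)).mul (by fun_prop)))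

theorem I_cpow_ofReal (β : ℝ) : Complex.I ^ (β : ℂ) =
    Complex.exp (β * ((π / 2 : ℝ) : ℂ) * Complex.I) := by
  rw [Complex.cpow_def_of_ne_zero Complex.I_ne_zero, Complex.log_I]
  congr 1; push_cast; ring

theorem rayIntegrand_half_pi {v : ℝ} (hv : 0 < v) :
    rayIntegrand β s t (π / 2) v = lineIntegrand β s t 0 v := by
  have h : Complex.exp (((π / 2 : ℝ) : ℂ) * Complex.I) = Complex.I := by
    push_cast; exact Complex.exp_pi_div_two_mul_I
  have h2 : (v * Complex.I : ℂ) ^ (β : ℂ) = (v : ℂ) ^ (β : ℂ) * Complex.I ^ (β : ℂ) := by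
    have hv' : (v : ℂ) ≠ 0 := by exact_mod_cast hv.ne'
    rw [Complex.cpow_def_of_ne_zero (mul_ne_zero hv' Complex.I_ne_zero),
      Complex.cpow_def_of_ne_zero hv', Complex.cpow_def_of_ne_zero Complex.I_ne_zero,
      Complex.log_ofReal_mul hv Complex.I_ne_zero, Complex.ofReal_log hv.le, ← Complex.exp_add,
      add_mul]
  rw [rayIntegrand, lineIntegrand, h, ← I_cpow_ofReal, Complex.ofReal_zero, zero_add, h2,
    Complex.ofReal_cpow hv.le]
  congr 1; ring

/-- Rotating the positive imaginary axis onto the negative real axis. -/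
theorem re_integral_lineIntegrand_zero (hβ0 : 0 < β) (hβ1 : β < 1) (hs : 0 < s) (ht : 0 < t) :
    (∫ v in Ioi 0, lineIntegrand β s t 0 v).re = -(∫ v in Ioi 0, rayIntegrand β s t π v).im := by
  have hπ := Real.pi_pos
  obtain ⟨C, b, hb, hCb⟩ := exists_norm_rayIntegrand_le hβ0 hβ1 hs ht
  have hint : ∀ q : ℝ, -1 < q →
      IntegrableOn (fun v : ℝ => v ^ q * (C * rexp (-(b * v ^ β)))) (Ioi 0) := fun q hq => by
    have h : IntegrableOn (fun v : ℝ => C * (v ^ q * rexp (-(b * v ^ β)))) (Ioi 0) :=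
      (integrableOn_rpow_mul_exp_neg hq hβ0 hb).const_mul C
    exact h.congr_fun (fun v _ => mul_left_comm _ _ _) measurableSet_Ioi
  have hk : ∀ φ ∈ Icc (π / 2) π, IntegrableOn
      (fun v => Complex.exp (φ * Complex.I) * rayIntegrand β s t φ v) (Ioi 0) := by
    intro φ hφ
    refine Integrable.const_mul (Integrable.mono' (hint 0 (by norm_num)) ?_ ?_) _
    · refine ContinuousOn.aestronglyMeasurable ?_ measurableSet_Ioi
      exact (continuousOn_rayIntegrand univ).comp (f := fun v => (φ, v)) (by fun_prop)
        (fun v hv => ⟨mem_univ _, hv⟩)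
    · filter_upwards [ae_restrict_mem measurableSet_Ioi] with v hv
      simpa using hCb φ hφ v hv
  have hnI : ∀ φ : ℝ, ‖Complex.exp (φ * Complex.I)‖ = 1 := Complex.norm_exp_ofReal_mul_I
  have hnI' : ∀ φ : ℝ, ‖Complex.exp (β * φ * Complex.I)‖ = 1 := fun φ => by
    rw [← Complex.ofReal_mul]; exact hnI _
  have key := integral_Ioi_sub_eq_neg_boundary (a := π / 2) (b := π) (by linarith)
    (k := fun φ v => Complex.exp (φ * Complex.I) * rayIntegrand β s t φ v)
    (m := fun φ v => Complex.I * Complex.exp (φ * Complex.I) * (v * rayIntegrand β s t φ v))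
    (D := fun φ v => Complex.I * Complex.exp (φ * Complex.I) *
      (1 + v * t * Complex.exp (φ * Complex.I) -
        s * β * ((v ^ β : ℝ) : ℂ) * Complex.exp (β * φ * Complex.I)) * rayIntegrand β s t φ v)
    (m₀ := fun _ => 0)
    (B := fun v => v ^ (0:ℝ) * (C * rexp (-(b * v ^ β))) +
      t * (v ^ (1:ℝ) * (C * rexp (-(b * v ^ β)))) +
      s * β * (v ^ β * (C * rexp (-(b * v ^ β)))))
    (((hint 0 (by norm_num)).add ((hint 1 (by norm_num)).const_mul t)).add
      ((hint β (by linarith)).const_mul _))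
    ?_ ?_ ?_ ?_ ?_ ?_ (hk _ ⟨le_rfl, by linarith⟩) (hk _ ⟨by linarith, le_rfl⟩)
  · have e1 : Complex.exp (((π / 2 : ℝ) : ℂ) * Complex.I) = Complex.I := by
      push_cast; exact Complex.exp_pi_div_two_mul_I
    simp only [integral_const_mul, Complex.exp_pi_mul_I, e1, intervalIntegral.integral_zero,
      neg_zero] at key
    rw [setIntegral_congr_fun measurableSet_Ioi fun v hv => rayIntegrand_half_pi hv] at key
    have := congrArg Complex.im key
    simp only [neg_one_mul, Complex.sub_im, Complex.neg_im, Complex.I_mul_im,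
      Complex.zero_im] at this
    linarith
  · intro v hv φ hφ
    have h1 := hasDerivAt_cexp_mul_ofReal_mul_I 1 φ
    simp only [Complex.ofReal_one, one_mul] at h1
    refine (h1.mul (hasDerivAt_rayIntegrand_left φ v)).congr_deriv ?_
    ring
  · intro φ hφ v hv
    refine (((Complex.ofRealCLM.hasDerivAt (x := v)).mul
      (hasDerivAt_rayIntegrand_right φ hv)).const_mul _).congr_deriv ?_
    have hvp : ((v ^ β : ℝ) : ℂ) = ((v ^ (β - 1) : ℝ) : ℂ) * v := by
      rw [← Complex.ofReal_mul, Real.rpow_sub_one hv.ne']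
      congr 1; field_simp
    simp only [hvp, Complex.ofRealCLM_apply, Complex.ofReal_one]
    ring
  · exact ((by fun_prop : ContinuousOn _ _).mul ((by fun_prop : ContinuousOn _ _).sub
      ((continuousOn_const.mul (continuousOn_ofReal_rpow_snd _ β)).mul (by fun_prop)))).mul
      (continuousOn_rayIntegrand _)
  · intro φ hφ v hv
    have hvβ := Real.rpow_nonneg hv.le β
    have h2 : ‖1 + v * t * Complex.exp (φ * Complex.I) -
        s * β * ((v ^ β : ℝ) : ℂ) * Complex.exp (β * φ * Complex.I)‖ ≤
        1 + v * t + s * β * v ^ β := by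
      refine (norm_sub_le _ _).trans (add_le_add ((norm_add_le _ _).trans ?_) ?_)
      · rw [norm_mul, hnI, norm_mul, Complex.norm_real, Complex.norm_real,
          Real.norm_of_nonneg hv.le, Real.norm_of_nonneg ht.le, norm_one, mul_one]
      · rw [norm_mul, hnI', norm_mul, norm_mul, Complex.norm_real, Complex.norm_real,
          Complex.norm_real, Real.norm_of_nonneg hs.le, Real.norm_of_nonneg hβ0.le,
          Real.norm_of_nonneg hvβ, mul_one]
    rw [norm_mul, norm_mul, norm_mul, hnI, Complex.norm_I, one_mul, one_mul]
    refine (mul_le_mul h2 (hCb φ hφ v hv) (norm_nonneg _) (by positivity)).trans_eq ?_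
    rw [Real.rpow_zero, Real.rpow_one]
    ring
  · intro φ hφ
    have hlim : Tendsto (fun v : ℝ => v * C) (𝓝[>] 0) (𝓝 0) := by
      have : ContinuousAt (fun v : ℝ => v * C) 0 := by fun_prop
      simpa using this.tendsto.mono_left nhdsWithin_le_nhds
    refine squeeze_zero_norm' ?_ hlim
    filter_upwards [self_mem_nhdsWithin] with v hv
    have hv : 0 < v := hv
    rw [norm_mul, norm_mul, norm_mul, hnI, Complex.norm_I, one_mul, one_mul, Complex.norm_real,
      Real.norm_of_nonneg hv.le]
    refine mul_le_mul_of_nonneg_left ((hCb φ hφ v hv).trans ?_) hv.le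
    have hC : 0 ≤ C := by
      have := (norm_nonneg _).trans (hCb φ hφ v hv)
      exact nonneg_of_mul_nonneg_left this (Real.exp_pos _)
    refine mul_le_of_le_one_right hC (Real.exp_le_one_iff.2 ?_)
    have := Real.rpow_nonneg hv.le β
    nlinarith
  · intro φ hφ
    have h := (tendsto_rpow_mul_exp_neg 1 hβ0 hb).const_mul C
    rw [mul_zero] at h
    refine squeeze_zero_norm' ?_ h
    filter_upwards [eventually_gt_atTop 0] with v hv
    rw [norm_mul, norm_mul, norm_mul, hnI, Complex.norm_I, one_mul, one_mul, Complex.norm_real,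
      Real.norm_of_nonneg hv.le]
    refine (mul_le_mul_of_nonneg_left (hCb φ hφ v hv) hv.le).trans_eq ?_
    rw [Real.rpow_one]; ring

end Ray

section Series

theorem Real.Gamma_mul_sin_pi_mul {x : ℝ} (hx : 0 < x) :
    Real.Gamma x * Real.sin (π * x) = π / Real.Gamma (1 - x) := by
  have h := Real.Gamma_mul_Gamma_one_sub x
  have hg := Real.Gamma_pos_of_pos hx
  by_cases hs : Real.sin (π * x) = 0
  · rw [hs, div_zero] at h
    rw [hs, (mul_eq_zero.1 h).resolve_left hg.ne', mul_zero, div_zero]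
  · have h' : Real.Gamma (1 - x) ≠ 0 := fun h0 => by
      rw [h0, mul_zero] at h
      exact (div_ne_zero Real.pi_ne_zero hs) h.symm
    rw [eq_div_iff hs] at h
    rw [eq_div_iff h', mul_right_comm, h]

theorem summable_pow_div_factorial_mul_Gamma {β : ℝ} (hβ0 : 0 < β) (hβ1 : β < 1) {x : ℝ}
    (hx : 0 < x) :
    Summable fun k : ℕ => x ^ k / (k.factorial : ℝ) * Real.Gamma (β * k + 1) := by
  have hfac : ∀ k : ℕ, (0 : ℝ) < k.factorial := fun k => by positivity
  have hΓ : ∀ k : ℕ, Real.Gamma (β * k + 1) ≤ (k.factorial : ℝ) ^ β := fun k => by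
    have h := Real.Gamma_mul_add_mul_le_rpow_Gamma_mul_rpow_Gamma (s := k + 1) (t := 1)
      (by positivity) one_pos hβ0 (sub_pos.2 hβ1) (by ring)
    rw [Real.Gamma_nat_eq_factorial, Real.Gamma_one, Real.one_rpow, mul_one, mul_one] at h
    convert h using 2
    ring
  have hmaj : Summable fun k : ℕ => x ^ k * (k.factorial : ℝ) ^ (β - 1) := by
    refine summable_of_ratio_test_tendsto_lt_one zero_lt_one
      (Eventually.of_forall fun k => (by have := hfac k; positivity)) ?_
    have h0 : Tendsto (fun k : ℕ => x * ((k : ℝ) + 1) ^ (β - 1)) atTop (𝓝 (x * 0)) := by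
      refine Tendsto.const_mul _ ?_
      have := (tendsto_rpow_neg_atTop (sub_pos.2 hβ1)).comp
        (tendsto_atTop_add_const_right _ (1 : ℝ) tendsto_natCast_atTop_atTop)
      simpa [Function.comp_def] using this
    rw [mul_zero] at h0
    refine h0.congr fun k => ?_
    have h1 := hfac k
    have h2 := hfac (k + 1)
    rw [Real.norm_of_nonneg (by positivity), Real.norm_of_nonneg (by positivity),
      Nat.factorial_succ, Nat.cast_mul, Real.mul_rpow (by positivity) (by positivity), pow_succ]
    push_cast
    field_simp
  refine hmaj.of_nonneg_of_le (fun k => ?_) fun k => ?_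
  · have := Real.Gamma_pos_of_pos (show 0 < β * k + 1 by positivity)
    positivity
  · rw [div_mul_eq_mul_div, mul_div_assoc]
    refine mul_le_mul_of_nonneg_left ?_ (by positivity)
    rw [Real.rpow_sub_one (hfac k).ne']
    exact div_le_div_of_nonneg_right (hΓ k) (hfac k).le

theorem Complex.exp_eq_tsum_div (z : ℂ) :
    Complex.exp z = ∑' k : ℕ, z ^ k / (k.factorial : ℂ) := by
  rw [Complex.exp_eq_exp_ℂ]
  exact (NormedSpace.expSeries_div_hasSum_exp z).tsum_eq.symm

theorem rayIntegrand_pi {β s t v : ℝ} : rayIntegrand β s t π v =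
    ∑' k : ℕ, ((-s : ℝ) * Complex.exp (β * π * Complex.I)) ^ k / (k.factorial : ℂ) *
      (((v ^ β) ^ k * rexp (-(t * v)) : ℝ) : ℂ) := by
  rw [rayIntegrand, Complex.exp_pi_mul_I, sub_eq_add_neg, Complex.exp_add,
    Complex.exp_eq_tsum_div (-_), ← tsum_mul_left]
  refine tsum_congr fun k => ?_
  have : (v : ℂ) * t * -1 = ((-(t * v) : ℝ) : ℂ) := by push_cast; ring
  rw [this, ← Complex.ofReal_exp]
  push_cast
  rw [show -((s : ℂ) * ((v ^ β : ℝ) : ℂ) * Complex.exp (β * π * Complex.I)) =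
    -(s : ℂ) * Complex.exp (β * π * Complex.I) * ((v ^ β : ℝ) : ℂ) by ring,
    mul_pow _ ((v ^ β : ℝ) : ℂ)]
  ring

theorem hasSum_integral_rayIntegrand_pi {β s t : ℝ} (hβ0 : 0 < β) (hβ1 : β < 1) (hs : 0 < s)
    (ht : 0 < t) :
    HasSum (fun k : ℕ => ((-s : ℝ) * Complex.exp (β * π * Complex.I)) ^ k / (k.factorial : ℂ) *
      (((1 / t) ^ (β * k + 1) * Real.Gamma (β * k + 1) : ℝ) : ℂ))
      (∫ v in Ioi (0 : ℝ), rayIntegrand β s t π v) := by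
  have hpow : ∀ k : ℕ, ∀ v ∈ Ioi (0 : ℝ), v ^ (β * k) * rexp (-(t * v)) =
      (v ^ β) ^ k * rexp (-(t * v)) := fun k v hv => by
    rw [Real.rpow_mul (le_of_lt hv), Real.rpow_natCast]
  have hval : ∀ k : ℕ, ∫ v in Ioi (0 : ℝ), (v ^ β) ^ k * rexp (-(t * v)) =
      (1 / t) ^ (β * k + 1) * Real.Gamma (β * k + 1) := fun k => by
    rw [← Real.integral_rpow_mul_exp_neg_mul_Ioi (by positivity) ht, add_sub_cancel_right,
      setIntegral_congr_fun measurableSet_Ioi (hpow k)]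
  have hint : ∀ k : ℕ, IntegrableOn (fun v : ℝ => (v ^ β) ^ k * rexp (-(t * v))) (Ioi 0) :=
    fun k => by
      have h := integrableOn_rpow_mul_exp_neg (q := β * k) (by have : 0 ≤ β * k := by positivity
                                                               linarith) one_pos ht
      simp only [Real.rpow_one] at h
      exact h.congr_fun (hpow k) measurableSet_Ioi
  have hw : ‖Complex.exp (β * π * Complex.I)‖ = 1 := by
    rw [← Complex.ofReal_mul]; exact Complex.norm_exp_ofReal_mul_I _
  have key := hasSum_integral_of_summable_integral_norm (μ := volume.restrict (Ioi (0 : ℝ)))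
    (F := fun (k : ℕ) v => ((-s : ℝ) * Complex.exp (β * π * Complex.I)) ^ k / (k.factorial : ℂ) *
      (((v ^ β) ^ k * rexp (-(t * v)) : ℝ) : ℂ)) (fun k => (hint k).ofReal.const_mul _) ?_
  · simp only [integral_const_mul, integral_complex_ofReal, hval, ← rayIntegrand_pi] at key
    exact key
  · have hs' : 0 < s / t ^ β := by positivity
    refine ((summable_pow_div_factorial_mul_Gamma hβ0 hβ1 hs').mul_left (1 / t)).congr fun k => ?_
    have : ∀ v ∈ Ioi (0 : ℝ), ‖((-s : ℝ) * Complex.exp (β * π * Complex.I)) ^ k /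
        (k.factorial : ℂ) * (((v ^ β) ^ k * rexp (-(t * v)) : ℝ) : ℂ)‖ =
        s ^ k / k.factorial * ((v ^ β) ^ k * rexp (-(t * v))) := fun v hv => by
      have hv' : (0 : ℝ) < v := hv
      rw [norm_mul, norm_div, norm_pow, norm_mul, hw, Complex.norm_real, Complex.norm_real,
        Complex.norm_natCast, norm_neg, Real.norm_of_nonneg hs.le, mul_one,
        Real.norm_of_nonneg (by positivity)]
    rw [setIntegral_congr_fun measurableSet_Ioi this, integral_const_mul, hval,
      Real.rpow_add (by positivity), Real.rpow_one, Real.rpow_mul (by positivity),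
      Real.rpow_natCast, div_pow, Real.div_rpow zero_le_one ht.le, Real.one_rpow, div_pow, one_pow]
    ring

theorem re_integral_lineIntegrand_eq_wrightG {β s t c : ℝ} (hβ0 : 0 < β) (hβ1 : β < 1)
    (hs : 0 < s) (ht : 0 < t) (hc : 0 ≤ c) :
    (∫ v in Ioi 0, lineIntegrand β s t c v).re = π * (β * s / t * wrightG β s t) := by
  rw [re_integral_lineIntegrand_eq hβ0 hβ1 hs hc, re_integral_lineIntegrand_zero hβ0 hβ1 hs ht,
    neg_eq_iff_eq_neg]
  have h := Complex.hasSum_im (hasSum_integral_rayIntegrand_pi hβ0 hβ1 hs ht)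
  have him : ∀ k : ℕ, (((-s : ℝ) * Complex.exp (β * π * Complex.I)) ^ k / (k.factorial : ℂ) *
      (((1 / t) ^ (β * k + 1) * Real.Gamma (β * k + 1) : ℝ) : ℂ)).im =
      (-s) ^ k / k.factorial * Real.sin (π * (β * k)) *
        ((1 / t) ^ (β * k + 1) * Real.Gamma (β * k + 1)) := fun k => by
    have : ((-s : ℝ) * Complex.exp (β * π * Complex.I)) ^ k / (k.factorial : ℂ) =
        (((-s) ^ k / k.factorial : ℝ) : ℂ) * Complex.exp ((π * (β * k) : ℝ) * Complex.I) := by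
      rw [mul_pow, ← Complex.exp_nat_mul]
      push_cast
      rw [show (k : ℂ) * (β * π * Complex.I) = π * (β * k) * Complex.I by ring]
      ring
    rw [this, Complex.im_mul_ofReal, Complex.im_ofReal_mul, Complex.exp_ofReal_mul_I_im]
  simp only [him] at h
  rw [← hasSum_nat_add_iff' 1] at h
  simp only [Finset.range_one, Finset.sum_singleton, Nat.cast_zero, mul_zero, Real.sin_zero,
    zero_mul, sub_zero] at h
  rw [← h.tsum_eq, wrightG, ← tsum_mul_left, ← tsum_mul_left, ← tsum_mul_left, ← tsum_neg]
  refine tsum_congr fun k => ?_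
  have hx : 0 < β * (k + 1 : ℝ) := by positivity
  push_cast
  rw [Real.Gamma_add_one hx.ne', Nat.factorial_succ,
    show ((1 / t : ℝ)) ^ (β * (k + 1 : ℝ) + 1) = t ^ (-β) * (1 / t ^ β) ^ k * (1 / t) by
      rw [Real.rpow_add (by positivity), Real.rpow_one, mul_add_one, Real.rpow_add (by positivity),
        Real.rpow_mul (by positivity), Real.rpow_natCast, Real.div_rpow zero_le_one ht.le,
        Real.one_rpow, Real.rpow_neg ht.le, one_div (t ^ β)]
      ring]
  have hr := Real.Gamma_mul_sin_pi_mul hx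
  calc _ = (-s) ^ (k + 1) / ((k + 1 : ℕ) * k.factorial : ℕ) * (β * (k + 1)) *
        (t ^ (-β) * (1 / t ^ β) ^ k * (1 / t)) *
        (Real.Gamma (β * (k + 1)) * Real.sin (π * (β * (k + 1)))) := by push_cast; ring
    _ = _ := by
      rw [hr, div_pow, div_pow, one_pow, pow_succ]
      have h1 : (k : ℝ) + 1 ≠ 0 := by positivity
      have h2 : (k.factorial : ℝ) ≠ 0 := by positivity
      have h3 : t ^ β ≠ 0 := by positivity
      push_cast
      by_cases h4 : Real.Gamma (1 - β * (k + 1)) = 0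
      · simp [h4]
      · field_simp

end Series

section Profile

/-- The self-similar profile of `wrightG`: `g_β(x;t) = t^{-β} M(x/t^β)`. -/
noncomputable def wrightM (β r : ℝ) : ℝ :=
  ∑' k : ℕ, (-r) ^ k / ((k.factorial : ℝ) * Real.Gamma (1 - β * (k + 1)))

theorem wrightG_eq_rpow_mul_wrightM (β x t : ℝ) :
    wrightG β x t = t ^ (-β) * wrightM β (x / t ^ β) := by
  simp only [wrightG, wrightM, neg_div]

theorem continuous_wrightM {β : ℝ} (hβ0 : 0 < β) (hβ1 : β < 1) : Continuous (wrightM β) := by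
  have hR : ∀ R : ℝ, 0 < R → ContinuousOn (wrightM β) (Icc (-R) R) := fun R hR => by
    have hsum := ((summable_nat_add_iff 1).2
      (summable_pow_div_factorial_mul_Gamma hβ0 hβ1 hR)).mul_left (1 / (β * R))
    refine continuousOn_tsum (fun k => by fun_prop) hsum fun k r hr => ?_
    have hx : 0 < β * (k + 1 : ℝ) := by positivity
    have hg := Real.Gamma_pos_of_pos hx
    have hG : |(Real.Gamma (1 - β * (k + 1)))⁻¹| ≤ Real.Gamma (β * (k + 1)) := by
      have h : (Real.Gamma (1 - β * (k + 1)))⁻¹ =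
          Real.Gamma (β * (k + 1)) * (Real.sin (π * (β * (k + 1))) / π) := by
        rw [← mul_div_assoc, Real.Gamma_mul_sin_pi_mul hx]
        field_simp
      rw [h, abs_mul, abs_of_pos hg, abs_div, abs_of_pos Real.pi_pos]
      refine mul_le_of_le_one_right hg.le ((div_le_one Real.pi_pos).2 ?_)
      linarith [Real.abs_sin_le_one (π * (β * (k + 1))), Real.pi_gt_three]
    have hrR : |r| ≤ R := abs_le.2 hr
    have hk : (0 : ℝ) < k.factorial := by positivity
    calc ‖(-r) ^ k / ((k.factorial : ℝ) * Real.Gamma (1 - β * (k + 1)))‖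
        = |r| ^ k / k.factorial * |(Real.Gamma (1 - β * (k + 1)))⁻¹| := by
          rw [div_eq_mul_inv, mul_inv, Real.norm_eq_abs, abs_mul, abs_mul, abs_pow, abs_neg,
            abs_inv, abs_of_pos hk, ← mul_assoc, div_eq_mul_inv]
      _ ≤ R ^ k / k.factorial * Real.Gamma (β * (k + 1)) := by gcongr
      _ = _ := by
          push_cast
          rw [Real.Gamma_add_one hx.ne', Nat.factorial_succ, pow_succ]
          push_cast
          field_simp
  refine continuous_iff_continuousAt.2 fun r => ?_
  have := abs_nonneg r
  refine (hR (|r| + 1) (by linarith)).continuousAt (Icc_mem_nhds ?_ ?_)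
  · linarith [neg_abs_le r]
  · linarith [le_abs_self r]

theorem exists_abs_wrightM_le {β : ℝ} (hβ0 : 0 < β) (hβ1 : β < 1) (a : ℝ) :
    ∃ C, 0 ≤ C ∧ ∀ r, 0 ≤ r → |wrightM β r| ≤ C * rexp (-(a * r)) := by
  set κ := Real.cos (β * (π / 2)) / 2 with hκ
  have hκ0 : 0 < κ := half_pos (cos_mul_half_pi_pos hβ0 hβ1)
  obtain ⟨B, hB⟩ := isCompact_Icc.exists_bound_of_continuousOn
    (continuous_wrightM hβ0 hβ1).continuousOn (s := Icc (0 : ℝ) 1)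
  have hB0 : 0 ≤ B := (norm_nonneg _).trans (hB 0 (by simp))
  set c := (|a| / κ) ^ (1 / β) with hc
  have hc0 : 0 ≤ c := by positivity
  have hca : κ * c ^ β = |a| := by
    rw [hc, ← Real.rpow_mul (by positivity), one_div_mul_cancel hβ0.ne', Real.rpow_one]
    field_simp
  set J := ∫ v in Ioi (0 : ℝ), rexp (-(κ * v ^ β)) with hJ
  have hJ0 : 0 ≤ J := integral_nonneg fun v => (Real.exp_pos _).le
  refine ⟨B * rexp |a| + rexp c * J / (π * β), by positivity, fun r hr => ?_⟩
  rw [add_mul]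
  rcases le_total r 1 with h1 | h1
  · refine le_add_of_le_of_nonneg ?_ (by positivity)
    refine (hB r ⟨hr, h1⟩).trans ?_
    rw [mul_assoc, ← Real.exp_add]
    refine le_mul_of_one_le_right hB0 (Real.one_le_exp ?_)
    nlinarith [le_abs_self a, abs_nonneg a]
  · refine le_add_of_nonneg_of_le (by positivity) ?_
    have hr0 : 0 < r := by linarith
    have h2 := re_integral_lineIntegrand_eq_wrightG (c := c) hβ0 hβ1 hr0 one_pos hc0
    rw [wrightG_eq_rpow_mul_wrightM, Real.one_rpow, Real.one_rpow, div_one, div_one, one_mul] at h2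
    have h3 : |π * (β * r * wrightM β r)| ≤ rexp (c * 1 - r * κ * c ^ β) * J := by
      rw [← h2]
      refine (Complex.abs_re_le_norm _).trans
        ((norm_integral_lineIntegrand_le hβ0 hβ1 hr0 hc0).trans ?_)
      rw [mul_div_assoc, ← hκ]
      refine mul_le_mul_of_nonneg_left ?_ (Real.exp_pos _).le
      refine setIntegral_mono_on (integrableOn_exp_neg_rpow hβ0 (by positivity))
        (integrableOn_exp_neg_rpow hβ0 hκ0) measurableSet_Ioi fun v hv => ?_
      have hv' : (0 : ℝ) < v := hv
      have : 0 ≤ κ * v ^ β := by positivity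
      refine Real.exp_le_exp.2 (neg_le_neg ?_)
      nlinarith
    rw [mul_one, mul_assoc r, hca, sub_eq_add_neg, Real.exp_add, ← mul_assoc, ← mul_assoc, abs_mul,
      abs_of_pos (by positivity : 0 < π * β * r)] at h3
    have h4 : rexp (-(r * |a|)) ≤ rexp (-(a * r)) :=
      Real.exp_le_exp.2 (by nlinarith [le_abs_self a])
    rw [div_mul_eq_mul_div, le_div_iff₀ (by positivity)]
    calc |wrightM β r| * (π * β) ≤ π * β * r * |wrightM β r| := by
          nlinarith [mul_nonneg (mul_pos Real.pi_pos hβ0).le (abs_nonneg (wrightM β r))]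
      _ ≤ rexp c * rexp (-(r * |a|)) * J := h3
      _ ≤ rexp c * rexp (-(a * r)) * J := by gcongr
      _ = _ := by ring

theorem re_integral_lineIntegrand_of_neg {β s t c : ℝ} (hβ0 : 0 < β) (hβ1 : β < 1)
    (hs : 0 < s) (ht : t < 0) (hc : 0 ≤ c) :
    (∫ v in Ioi 0, lineIntegrand β s t c v).re = 0 := by
  rw [re_integral_lineIntegrand_eq hβ0 hβ1 hs hc]
  set J := ∫ v in Ioi (0 : ℝ), rexp (-(s * Real.cos (β * (π / 2)) / 2 * v ^ β)) with hJ
  have hJ0 : 0 ≤ J := integral_nonneg fun v => (Real.exp_pos _).le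
  have hlim : Tendsto (fun d : ℝ => rexp (d * t) * J) atTop (𝓝 (0 * J)) :=
    (Real.tendsto_exp_atBot.comp (tendsto_id.atTop_mul_const_of_neg ht)).mul_const J
  rw [zero_mul] at hlim
  refine abs_eq_zero.1 (le_antisymm (ge_of_tendsto hlim ?_) (abs_nonneg _))
  filter_upwards [eventually_ge_atTop 0] with d hd
  rw [← re_integral_lineIntegrand_eq hβ0 hβ1 hs hd]
  refine (Complex.abs_re_le_norm _).trans
    ((norm_integral_lineIntegrand_le hβ0 hβ1 hs hd).trans ?_)
  have := cos_mul_half_pi_pos hβ0 hβ1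
  refine mul_le_mul_of_nonneg_right (Real.exp_le_exp.2 ?_) hJ0
  have : 0 ≤ s * Real.cos (β * (π / 2)) / 2 * d ^ β := by positivity
  linarith

end Profile

section Kernel

/-- The Riemann-Liouville integral of order `1 - β` maps the first-passage density
`β s / τ * g_β(s;τ)` to `g_β(s;t)`. -/
theorem integral_rpow_mul_wrightG {β s t : ℝ} (hβ0 : 0 < β) (hβ1 : β < 1) (hs : 0 < s)
    (ht : 0 < t) :
    ∫ τ in (0 : ℝ)..t, (t - τ) ^ (-β) * (β * s / τ * wrightG β s τ) =
      Real.Gamma (1 - β) * wrightG β s t := by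
  set f : ℝ → ℝ → ℂ := fun x v => ((x ^ (-β) : ℝ) : ℂ) * lineIntegrand β s (t - x) 1 v with hf
  set b := s * Real.cos (β * (π / 2)) / 2 with hb
  have hb0 : 0 < b := by have := cos_mul_half_pi_pos hβ0 hβ1; positivity
  have hline : ∀ x v : ℝ, lineIntegrand β s (t - x) 1 v =
      Complex.exp (-(((1 : ℝ) + v * Complex.I) * x)) * lineIntegrand β s t 1 v := fun x v => by
    rw [lineIntegrand, lineIntegrand, ← Complex.exp_add]
    congr 1
    push_cast
    ring
  have hint : Integrable (Function.uncurry f)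
      ((volume.restrict (Ioi (0 : ℝ))).prod (volume.restrict (Ioi (0 : ℝ)))) := by
    have hx : IntegrableOn (fun x : ℝ => x ^ (-β) * rexp (-(1 * x ^ (1 : ℝ)))) (Ioi 0) :=
      integrableOn_rpow_mul_exp_neg (by linarith) one_pos one_pos
    have hv := (integrableOn_exp_neg_rpow hβ0 hb0).const_mul (rexp (1 * t - b * 1 ^ β))
    refine (Integrable.mul_prod hx hv).mono' ?_ ?_
    · rw [Measure.prod_restrict]
      refine ContinuousOn.aestronglyMeasurable ?_ (measurableSet_Ioi.prod measurableSet_Ioi)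
      simp only [hf, Function.uncurry_def, hline]
      refine ContinuousOn.mul ?_ (ContinuousOn.mul (by fun_prop) ?_)
      · refine Complex.continuous_ofReal.comp_continuousOn ?_
        exact continuousOn_fst.rpow_const fun p hp => Or.inl (ne_of_gt hp.1)
      · exact continuousOn_lineIntegrand.comp (f := fun p : ℝ × ℝ => ((1 : ℝ), p.2)) (by fun_prop)
          (fun p hp => ⟨mem_univ _, hp.2⟩)
    · rw [Measure.prod_restrict]
      filter_upwards [ae_restrict_mem (measurableSet_Ioi.prod measurableSet_Ioi)] with p hp
      have hp1 : (0 : ℝ) < p.1 := hp.1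
      have h := norm_lineIntegrand_le (t := t - p.1) hβ0 hβ1 hs zero_le_one (le_of_lt hp.2)
      rw [← hb] at h
      simp only [Function.uncurry_def, hf]
      rw [norm_mul, Complex.norm_real, Real.norm_of_nonneg (by positivity)]
      refine (mul_le_mul_of_nonneg_left h (by positivity)).trans (le_of_eq ?_)
      rw [mul_assoc, ← Real.exp_add, ← Real.exp_add, ← Real.exp_add, Real.rpow_one]
      ring_nf
  have hin : ∀ v : ℝ, ∫ x in Ioi (0 : ℝ), f x v =
      Real.Gamma (1 - β) * (((1 : ℝ) + v * Complex.I) ^ ((β : ℂ) - 1) *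
        lineIntegrand β s t 1 v) := fun v => by
    have h := integral_rpow_mul_cexp_neg_mul_Ioi (sub_pos.2 hβ1)
      (l := (1 : ℝ) + v * Complex.I) (by simp)
    simp only [hf, hline, ← mul_assoc]
    rw [integral_mul_const]
    congr 1
    rw [show (1 - β - 1) = -β by ring] at h
    rw [h]
    congr 2
    push_cast
    ring
  have hleft : IntegrableOn (fun x => ∫ v in Ioi (0 : ℝ), f x v) (Ioi 0) :=
    hint.integral_prod_left
  have hswap := integral_integral_swap hint
  simp only [hin, integral_const_mul] at hswap
  have hre := congrArg Complex.re hswap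
  rw [Complex.re_ofReal_mul, ← Complex.reCLM_apply, ← ContinuousLinearMap.integral_comp_comm _
    hleft] at hre
  have hmul := mul_re_integral_lineIntegrand (t := t) hβ0 hβ1 hs one_pos
  rw [re_integral_lineIntegrand_eq_wrightG hβ0 hβ1 hs ht zero_le_one] at hmul
  have hR : (∫ v : ℝ in Ioi 0, ((1 : ℝ) + v * Complex.I) ^ ((β : ℂ) - 1) *
      lineIntegrand β s t 1 v).re = π * wrightG β s t := by
    have : s * β ≠ 0 := by positivity
    refine mul_left_cancel₀ this ?_
    rw [← hmul]
    field_simp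
  rw [hR] at hre
  have hL : ∫ x in Ioi (0 : ℝ), Complex.reCLM (∫ v in Ioi 0, f x v) =
      ∫ x in (0 : ℝ)..t, π * ((t - (t - x)) ^ (-β) *
        (β * s / (t - x) * wrightG β s (t - x))) := by
    have hfx : ∀ x : ℝ, Complex.reCLM (∫ v in Ioi 0, f x v) =
        x ^ (-β) * (∫ v in Ioi 0, lineIntegrand β s (t - x) 1 v).re := fun x => by
      simp only [hf, integral_const_mul, Complex.reCLM_apply, Complex.re_ofReal_mul]
    rw [intervalIntegral.integral_of_le ht.le, integral_Ioc_eq_integral_Ioo,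
      setIntegral_eq_of_subset_of_ae_sdiff_eq_zero measurableSet_Ioi.nullMeasurableSet
        (fun x hx => hx.1 : Ioo 0 t ⊆ Ioi 0) ?_]
    · refine setIntegral_congr_fun measurableSet_Ioo fun x hx => ?_
      simp only [hfx]
      rw [re_integral_lineIntegrand_eq_wrightG hβ0 hβ1 hs (sub_pos.2 hx.2) zero_le_one,
        sub_sub_cancel]
      ring
    · filter_upwards [Measure.ae_ne volume t] with x hxt hx
      rw [hfx, re_integral_lineIntegrand_of_neg hβ0 hβ1 hs _ zero_le_one, mul_zero]
      refine sub_neg.2 (lt_of_le_of_ne ?_ hxt.symm)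
      by_contra! h
      exact hx.2 ⟨hx.1, h⟩
  rw [hL, intervalIntegral.integral_const_mul, intervalIntegral.integral_comp_sub_left
    (fun τ => (t - τ) ^ (-β) * (β * s / τ * wrightG β s τ)), sub_self, sub_zero] at hre
  refine mul_left_cancel₀ Real.pi_ne_zero ?_
  rw [hre]
  ring

end Kernel

section CaputoTransform

theorem integral_mul_wrightG_eq (β : ℝ) (f : ℝ → ℝ) {t : ℝ} (ht : 0 < t) :
    ∫ s in Ioi (0 : ℝ), f s * wrightG β s t =
      ∫ r in Ioi (0 : ℝ), f (t ^ β * r) * wrightM β r := by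
  have hb : 0 < t ^ β := by positivity
  have h := integral_comp_mul_left_Ioi (fun s => f s * wrightM β (s / t ^ β)) 0 hb
  simp only [mul_div_cancel_left₀ _ hb.ne', mul_zero, smul_eq_mul] at h
  rw [h, ← integral_const_mul]
  refine integral_congr_ae (Eventually.of_forall fun s => ?_)
  simp only [wrightG_eq_rpow_mul_wrightM, Real.rpow_neg ht.le]
  ring

theorem exists_abs_comp_mul_wrightM_le {β : ℝ} (hβ0 : 0 < β) (hβ1 : β < 1) {f : ℝ → ℝ}
    (hf : ExpOrder f) (B : ℝ) :
    ∃ K, 0 ≤ K ∧ ∀ b r, 0 ≤ b → b ≤ B → 0 ≤ r → |f (b * r) * wrightM β r| ≤ K * rexp (-r) := by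
  obtain ⟨C, a, hC, ha, hfb⟩ := hf
  obtain ⟨D, hD, hM⟩ := exists_abs_wrightM_le hβ0 hβ1 (a * B + 1)
  refine ⟨C * D, by positivity, fun b r hb hbB hr => ?_⟩
  rw [abs_mul]
  calc |f (b * r)| * |wrightM β r| ≤ C * rexp (a * (B * r)) * (D * rexp (-((a * B + 1) * r))) := by
        refine mul_le_mul ((hfb _ (by positivity)).trans ?_) (hM r hr) (abs_nonneg _)
          (by positivity)
        gcongr
    _ = C * D * (rexp (a * (B * r)) * rexp (-((a * B + 1) * r))) := by ring
    _ = _ := by rw [← Real.exp_add]; ring_nf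

theorem integrableOn_rpow_mul_exp_neg_Ioi {q : ℝ} (hq : -1 < q) {b : ℝ} (hb : 0 < b) :
    IntegrableOn (fun x : ℝ => x ^ q * rexp (-(b * x))) (Ioi 0) := by
  simpa only [Real.rpow_one] using integrableOn_rpow_mul_exp_neg hq one_pos hb

theorem aestronglyMeasurable_comp_mul_wrightM {β : ℝ} (hβ0 : 0 < β) (hβ1 : β < 1) {f : ℝ → ℝ}
    (hf : ContinuousOn f (Ioi 0)) {b : ℝ} (hb : 0 < b) :
    AEStronglyMeasurable (fun r => f (b * r) * wrightM β r) (volume.restrict (Ioi 0)) := by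
  refine ContinuousOn.aestronglyMeasurable ?_ measurableSet_Ioi
  exact (hf.comp (by fun_prop) fun r hr => mul_pos hb hr).mul (continuous_wrightM hβ0 hβ1).continuousOn

theorem integrableOn_comp_mul_wrightM {β : ℝ} (hβ0 : 0 < β) (hβ1 : β < 1) {f : ℝ → ℝ}
    (hf : ContinuousOn f (Ioi 0)) (hfe : ExpOrder f) {b : ℝ} (hb : 0 < b) :
    IntegrableOn (fun r => f (b * r) * wrightM β r) (Ioi 0) := by
  obtain ⟨K, -, hK⟩ := exists_abs_comp_mul_wrightM_le hβ0 hβ1 hfe b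
  refine Integrable.mono' ((integrableOn_exp_neg_Ioi 0).const_mul K)
    (aestronglyMeasurable_comp_mul_wrightM hβ0 hβ1 hf hb) ?_
  filter_upwards [ae_restrict_mem measurableSet_Ioi] with r hr
  exact hK b r hb.le le_rfl (le_of_lt hr)

theorem integrableOn_mul_wrightG {β : ℝ} (hβ0 : 0 < β) (hβ1 : β < 1) {f : ℝ → ℝ}
    (hf : ContinuousOn f (Ioi 0)) (hfe : ExpOrder f) {t : ℝ} (ht : 0 < t) :
    IntegrableOn (fun s => f s * wrightG β s t) (Ioi 0) := by
  have hb : 0 < t ^ β := by positivity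
  have h := (integrableOn_Ioi_comp_mul_left_iff
    (fun s => f s * wrightM β (s / t ^ β)) 0 hb).1 (by
      simpa only [mul_div_cancel_left₀ _ hb.ne'] using
        integrableOn_comp_mul_wrightM hβ0 hβ1 hf hfe hb)
  rw [mul_zero] at h
  refine (h.const_mul (t ^ (-β))).congr (Eventually.of_forall fun s => ?_)
  simp only [wrightG_eq_rpow_mul_wrightM]
  ring

theorem hasDerivAt_integral_comp_mul_wrightM {β : ℝ} (hβ0 : 0 < β) (hβ1 : β < 1) {w w' : ℝ → ℝ}
    (hw : ∀ s, 0 < s → HasDerivAt w (w' s) s) (hw'c : ContinuousOn w' (Ioi 0))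
    (hwe : ExpOrder w) (hw'e : ExpOrder w') {t : ℝ} (ht : 0 < t) :
    HasDerivAt (fun x => ∫ r in Ioi (0 : ℝ), w (x ^ β * r) * wrightM β r)
      (∫ r in Ioi (0 : ℝ), w' (t ^ β * r) * wrightM β r * (β * t ^ (β - 1) * r)) t := by
  have hwc : ContinuousOn w (Ioi 0) := fun s hs => (hw s hs).continuousAt.continuousWithinAt
  obtain ⟨K, hK0, hK⟩ := exists_abs_comp_mul_wrightM_le hβ0 hβ1 hw'e ((2 * t) ^ β)
  refine (hasDerivAt_integral_of_dominated_loc_of_deriv_le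
    (bound := fun r => K * (β * (t / 2) ^ (β - 1)) * (r ^ (1 : ℝ) * rexp (-(1 * r))))
    (F := fun x r => w (x ^ β * r) * wrightM β r)
    (F' := fun x r => w' (x ^ β * r) * wrightM β r * (β * x ^ (β - 1) * r))
    (Ioo_mem_nhds (half_lt_self ht) (by linarith : t < 2 * t)) ?_
    (integrableOn_comp_mul_wrightM hβ0 hβ1 hwc hwe (by positivity)) ?_ ?_
    ((integrableOn_rpow_mul_exp_neg_Ioi (by norm_num) one_pos).const_mul _) ?_).2
  · filter_upwards [eventually_gt_nhds ht] with x hx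
    exact aestronglyMeasurable_comp_mul_wrightM hβ0 hβ1 hwc (by positivity)
  · exact (aestronglyMeasurable_comp_mul_wrightM hβ0 hβ1 hw'c (by positivity)).mul
      (by fun_prop)
  · filter_upwards [ae_restrict_mem measurableSet_Ioi] with r hr x hx
    have hr' : (0 : ℝ) < r := hr
    have hx0 : 0 < x := (half_pos ht).trans hx.1
    have h1 := hK (x ^ β) r (by positivity) (Real.rpow_le_rpow hx0.le hx.2.le hβ0.le) hr'.le
    have h2 : x ^ (β - 1) ≤ (t / 2) ^ (β - 1) :=
      Real.rpow_le_rpow_of_nonpos (half_pos ht) hx.1.le (by linarith)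
    rw [norm_mul, Real.norm_eq_abs, Real.norm_of_nonneg (by positivity), Real.rpow_one, one_mul]
    calc _ ≤ K * rexp (-r) * (β * (t / 2) ^ (β - 1) * r) := by gcongr
      _ = _ := by ring
  · filter_upwards [ae_restrict_mem measurableSet_Ioi] with r hr x hx
    have hr' : (0 : ℝ) < r := hr
    have hx0 : 0 < x := (half_pos ht).trans hx.1
    have h1 := (Real.hasDerivAt_rpow_const (p := β) (Or.inl hx0.ne')).mul_const r
    have h2 := ((hw (x ^ β * r) (by positivity)).comp x h1).mul_const (wrightM β r)
    exact h2.congr_deriv (by ring)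

theorem integrableOn_rpow_mul_sub_rpow {β t : ℝ} (hβ0 : 0 < β) (hβ1 : β < 1) (ht : 0 < t) :
    IntegrableOn (fun τ : ℝ => (t - τ) ^ (-β) * τ ^ (β - 1)) (Ioc 0 t) := by
  have h1 : IntegrableOn (fun τ : ℝ => τ ^ (β - 1)) (Ioc 0 t) :=
    (intervalIntegrable_iff_integrableOn_Ioc_of_le ht.le).1
      (intervalIntegral.intervalIntegrable_rpow' (by linarith))
  have h2 : IntegrableOn (fun τ : ℝ => (t - τ) ^ (-β)) (Ioc 0 t) := by
    refine (intervalIntegrable_iff_integrableOn_Ioc_of_le ht.le).1 ?_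
    have := ((intervalIntegral.intervalIntegrable_rpow' (a := 0) (b := t) (r := -β)
      (by linarith)).comp_sub_left t).symm
    simpa using this
  refine Integrable.mono' ((h1.const_mul ((t / 2) ^ (-β))).add (h2.const_mul ((t / 2) ^ (β - 1))))
    (by fun_prop) ?_
  filter_upwards [ae_restrict_mem measurableSet_Ioc] with τ hτ
  have hτ0 : 0 < τ := hτ.1
  have hτt : 0 ≤ t - τ := sub_nonneg.2 hτ.2
  rw [Real.norm_of_nonneg (by positivity)]
  simp only [Pi.add_apply]
  rcases le_total τ (t / 2) with h | h
  · refine le_add_of_le_of_nonneg (mul_le_mul_of_nonneg_right ?_ (by positivity)) (by positivity)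
    exact Real.rpow_le_rpow_of_nonpos (half_pos ht) (by linarith) (by linarith)
  · refine le_add_of_nonneg_of_le (by positivity) ?_
    rw [mul_comm]
    refine mul_le_mul_of_nonneg_right ?_ (by positivity)
    exact Real.rpow_le_rpow_of_nonpos (half_pos ht) h (by linarith)

theorem integrable_rpow_mul_mul_wrightG {β : ℝ} (hβ0 : 0 < β) (hβ1 : β < 1) {f : ℝ → ℝ}
    (hf : ContinuousOn f (Ioi 0)) (hfe : ExpOrder f) {t : ℝ} (ht : 0 < t) :
    Integrable (Function.uncurry fun τ s : ℝ =>
        f s * ((t - τ) ^ (-β) * (β * s / τ * wrightG β s τ)))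
      ((volume.restrict (Ioc 0 t)).prod (volume.restrict (Ioi 0))) := by
  obtain ⟨K, hK0, hK⟩ := exists_abs_comp_mul_wrightM_le hβ0 hβ1 hfe (t ^ β)
  have hsec : ∀ τ : ℝ, 0 < τ →
      ∫ s in Ioi (0 : ℝ), s ^ (1 : ℝ) * rexp (-(τ ^ (-β) * s)) = τ ^ (2 * β) := fun τ hτ => by
    have h := Real.integral_rpow_mul_exp_neg_mul_Ioi two_pos (Real.rpow_pos_of_pos hτ (-β))
    rw [Real.Gamma_two, mul_one, one_div, ← Real.rpow_neg hτ.le, neg_neg, ← Real.rpow_mul hτ.le,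
      mul_comm β] at h
    rw [← h]
    norm_num
  have hmaj : Integrable (fun p : ℝ × ℝ => (t - p.1) ^ (-β) * p.1 ^ (-1 - β) *
      (p.2 ^ (1 : ℝ) * rexp (-(p.1 ^ (-β) * p.2))))
      ((volume.restrict (Ioc 0 t)).prod (volume.restrict (Ioi 0))) := by
    refine (integrable_prod_iff (by fun_prop)).2 ⟨?_, ?_⟩
    · filter_upwards [ae_restrict_mem measurableSet_Ioc] with τ hτ
      exact (integrableOn_rpow_mul_exp_neg_Ioi (by norm_num)
        (Real.rpow_pos_of_pos hτ.1 _)).const_mul _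
    · refine (integrableOn_rpow_mul_sub_rpow hβ0 hβ1 ht).congr ?_
      filter_upwards [ae_restrict_mem measurableSet_Ioc] with τ hτ
      have hτ0 : 0 < τ := hτ.1
      have hτt : 0 ≤ t - τ := sub_nonneg.2 hτ.2
      have : ∀ s ∈ Ioi (0 : ℝ), ‖(t - τ) ^ (-β) * τ ^ (-1 - β) *
          (s ^ (1 : ℝ) * rexp (-(τ ^ (-β) * s)))‖ = (t - τ) ^ (-β) * τ ^ (-1 - β) *
          (s ^ (1 : ℝ) * rexp (-(τ ^ (-β) * s))) := fun s hs => by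
        have hs' : (0 : ℝ) < s := hs
        exact Real.norm_of_nonneg (by positivity)
      rw [setIntegral_congr_fun measurableSet_Ioi this, integral_const_mul, hsec τ hτ0, mul_assoc,
        ← Real.rpow_add hτ0]
      ring_nf
  refine (hmaj.const_mul (K * β)).mono' ?_ ?_
  · have h1 : AEStronglyMeasurable (fun p : ℝ × ℝ => f p.2)
        ((volume.restrict (Ioc 0 t)).prod (volume.restrict (Ioi 0))) :=
      (hf.aestronglyMeasurable measurableSet_Ioi).comp_snd
    refine h1.mul (Measurable.aestronglyMeasurable ?_)
    simp only [wrightG_eq_rpow_mul_wrightM]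
    have := (continuous_wrightM hβ0 hβ1).measurable
    fun_prop
  · rw [Measure.prod_restrict]
    filter_upwards [ae_restrict_mem (measurableSet_Ioc.prod measurableSet_Ioi)] with p hp
    obtain ⟨τ, s⟩ := p
    have hτ0 : 0 < τ := hp.1.1
    have hτt : 0 ≤ t - τ := sub_nonneg.2 hp.1.2
    have hs : 0 < s := hp.2
    have h := hK (τ ^ β) (s / τ ^ β) (by positivity)
      (Real.rpow_le_rpow hτ0.le hp.1.2 hβ0.le) (by positivity)
    rw [mul_div_cancel₀ _ (by positivity)] at h
    simp only [Function.uncurry_apply_pair, wrightG_eq_rpow_mul_wrightM]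
    calc _ = ‖f s * wrightM β (s / τ ^ β)‖ *
          ‖(t - τ) ^ (-β) * (β * s / τ * τ ^ (-β))‖ := by rw [← norm_mul]; ring_nf
      _ ≤ K * rexp (-(s / τ ^ β)) * ((t - τ) ^ (-β) * (β * s / τ * τ ^ (-β))) := by
          rw [Real.norm_of_nonneg (by positivity :
            0 ≤ (t - τ) ^ (-β) * (β * s / τ * τ ^ (-β)))]
          gcongr
          exact h
      _ = _ := by
          rw [show -1 - β = -1 + -β by ring, Real.rpow_add hτ0, Real.rpow_neg_one, Real.rpow_one,
            Real.rpow_neg hτ0.le β]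
          ring_nf

/-- The Caputo derivative of the Wright transform is the Wright transform of the derivative. -/
theorem caputo_integral_mul_wrightG {β : ℝ} (hβ0 : 0 < β) (hβ1 : β < 1) {w w' u : ℝ → ℝ}
    (hw : ∀ s, 0 < s → HasDerivAt w (w' s) s) (hw'c : ContinuousOn w' (Ioi 0))
    (hwe : ExpOrder w) (hw'e : ExpOrder w')
    (hu : ∀ τ, 0 < τ → u τ = ∫ s in Ioi (0 : ℝ), w s * wrightG β s τ) {t : ℝ} (ht : 0 < t) :
    caputo β u t = ∫ s in Ioi (0 : ℝ), w' s * wrightG β s t := by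
  have hd : ∀ τ, 0 < τ →
      deriv u τ = ∫ s in Ioi (0 : ℝ), w' s * (β * s / τ * wrightG β s τ) := fun τ hτ => by
    have h := hasDerivAt_integral_comp_mul_wrightM hβ0 hβ1 hw hw'c hwe hw'e hτ
    have he : u =ᶠ[𝓝 τ] fun x => ∫ r in Ioi (0 : ℝ), w (x ^ β * r) * wrightM β r := by
      filter_upwards [eventually_gt_nhds hτ] with x hx
      rw [hu x hx, integral_mul_wrightG_eq β w hx]
    rw [(h.congr_of_eventuallyEq he).deriv]
    have h2 := integral_mul_wrightG_eq β (fun s => w' s * (β * s / τ)) hτ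
    simp only [mul_assoc (w' _)] at h2 ⊢
    rw [h2]
    refine integral_congr_ae (Eventually.of_forall fun r => ?_)
    simp only [Real.rpow_sub_one hτ.ne']
    ring
  have hi := integral_integral_swap (integrable_rpow_mul_mul_wrightG hβ0 hβ1 hw'c hw'e ht)
  have hL : ∫ τ in (0 : ℝ)..t, (t - τ) ^ (-β) * deriv u τ = ∫ τ in Ioc 0 t,
      ∫ s in Ioi (0 : ℝ), w' s * ((t - τ) ^ (-β) * (β * s / τ * wrightG β s τ)) := by
    rw [intervalIntegral.integral_of_le ht.le]
    refine setIntegral_congr_fun measurableSet_Ioc fun τ hτ => ?_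
    simp only [hd τ hτ.1, ← integral_const_mul]
    refine integral_congr_ae (Eventually.of_forall fun s => ?_)
    simp only
    ring
  have hR : ∀ s ∈ Ioi (0 : ℝ), ∫ τ in Ioc 0 t,
      w' s * ((t - τ) ^ (-β) * (β * s / τ * wrightG β s τ)) =
      Real.Gamma (1 - β) * (w' s * wrightG β s t) := fun s hs => by
    rw [integral_const_mul, ← intervalIntegral.integral_of_le ht.le,
      integral_rpow_mul_wrightG hβ0 hβ1 hs ht]
    ring
  rw [caputo, hL, hi, setIntegral_congr_fun measurableSet_Ioi hR, integral_const_mul,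
    one_div, inv_mul_cancel_left₀ (Real.Gamma_pos_of_pos (sub_pos.2 hβ1)).ne']

end CaputoTransform

theorem ContDiffOn.differentiableAt_iteratedDeriv_of_isOpen {z : ℝ → ℝ} {U : Set ℝ} {n k : ℕ}
    (hz : ContDiffOn ℝ n z U) (hU : IsOpen U) (hk : k < n) {s : ℝ} (hs : s ∈ U) :
    DifferentiableAt ℝ (iteratedDeriv k z) s := by
  have h := (hz.differentiableOn_iteratedDerivWithin (by exact_mod_cast hk) hU.uniqueDiffOn s
    hs).differentiableAt (hU.mem_nhds hs)
  exact h.congr_of_eventuallyEq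
    ((iteratedDerivWithin_of_isOpen hU).symm.eventuallyEq_of_mem (hU.mem_nhds hs))

theorem ContDiffOn.continuousOn_iteratedDeriv_of_isOpen {z : ℝ → ℝ} {U : Set ℝ} {n k : ℕ}
    (hz : ContDiffOn ℝ n z U) (hU : IsOpen U) (hk : k ≤ n) :
    ContinuousOn (iteratedDeriv k z) U :=
  (hz.continuousOn_iteratedDerivWithin (by exact_mod_cast hk) hU.uniqueDiffOn).congr
    (iteratedDerivWithin_of_isOpen hU).symm

theorem iterate_caputo_integral_mul_wrightG {β : ℝ} (hβ0 : 0 < β) (hβ1 : β < 1) {n : ℕ}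
    {z y : ℝ → ℝ} (hz : ContDiffOn ℝ n z (Ioi 0)) (hze : ∀ k ≤ n, ExpOrder (iteratedDeriv k z))
    (hy : ∀ τ, 0 < τ → y τ = ∫ s in Ioi (0 : ℝ), z s * wrightG β s τ) {k : ℕ} (hk : k ≤ n)
    {t : ℝ} (ht : 0 < t) :
    (caputo β)^[k] y t = ∫ s in Ioi (0 : ℝ), iteratedDeriv k z s * wrightG β s t := by
  induction k generalizing t with
  | zero => simpa using hy t ht
  | succ k ih =>
    rw [Function.iterate_succ_apply']
    refine caputo_integral_mul_wrightG hβ0 hβ1 (fun s hs => ?_)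
      (hz.continuousOn_iteratedDeriv_of_isOpen isOpen_Ioi hk) (hze k (by omega)) (hze _ hk)
      (fun τ hτ => ih (by omega) hτ) ht
    rw [iteratedDeriv_succ]
    exact (hz.differentiableAt_iteratedDeriv_of_isOpen isOpen_Ioi hk hs).hasDerivAt

/-- If `z ∈ Cⁿ([0,∞))` (with `z` and all derivatives up to order `n` of
exponential order) solves `∑_{k=1}^n a_k z^{(k)} + a_{n+1} z = F` on `[0,∞)` with `F`
continuous and of exponential order, and `y(t) = ∫_0^∞ z(s) g_β(s;t) ds`,
`F_β(t) = ∫_0^∞ F(s) g_β(s;t) ds`, with matching initial conditions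
`(D_c^β)^k y(0⁺) = z^{(k)}(0)` for `k = 0,…,n−1`, then `y` solves the fractional ODE
`∑_{k=1}^n a_k (D_c^β)^k y + a_{n+1} y = F_β` on `(0,∞)`. -/
theorem wrightTransform_solves_fractional_ode (β : ℝ) (hβ0 : 0 < β) (hβ1 : β < 1)
    (n : ℕ) (hn : 1 ≤ n) (a : ℕ → ℝ) (F z : ℝ → ℝ)
    (hF : ContinuousOn F (Set.Ici 0)) (hFe : ExpOrder F)
    (hz : ContDiffOn ℝ n z (Set.Ici 0))
    (hze : ∀ k ≤ n, ExpOrder (iteratedDeriv k z))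
    (hode : ∀ t : ℝ, 0 ≤ t →
      ∑ k ∈ Finset.Icc 1 n, a k * iteratedDeriv k z t + a (n + 1) * z t = F t)
    (y Fβ : ℝ → ℝ)
    (hy : ∀ τ : ℝ, 0 < τ → y τ = ∫ s in Set.Ioi (0:ℝ), z s * wrightG β s τ)
    (hFβ : ∀ τ : ℝ, 0 < τ → Fβ τ = ∫ s in Set.Ioi (0:ℝ), F s * wrightG β s τ)
    (hmatch : ∀ k < n, Filter.Tendsto ((caputo β)^[k] y)
      (nhdsWithin 0 (Set.Ioi 0)) (nhds (iteratedDeriv k z 0))) :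
    ∀ t : ℝ, 0 < t →
      ∑ k ∈ Finset.Icc 1 n, a k * (caputo β)^[k] y t + a (n + 1) * y t = Fβ t := by

  intro t ht
  have hz' : ContDiffOn ℝ n z (Ioi 0) := hz.mono Ioi_subset_Ici_self
  have hint : ∀ k ≤ n, IntegrableOn (fun s => iteratedDeriv k z s * wrightG β s t) (Ioi 0) :=
    fun k hk => integrableOn_mul_wrightG hβ0 hβ1
      (hz'.continuousOn_iteratedDeriv_of_isOpen isOpen_Ioi hk) (hze k hk) ht
  have hint0 : IntegrableOn (fun s => z s * wrightG β s t) (Ioi 0) := by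
    simpa using hint 0 n.zero_le
  have hsum : ∀ k ∈ Finset.Icc 1 n, a k * (caputo β)^[k] y t =
      ∫ s in Ioi (0 : ℝ), a k * (iteratedDeriv k z s * wrightG β s t) := fun k hk => by
    rw [iterate_caputo_integral_mul_wrightG hβ0 hβ1 hz' hze hy (Finset.mem_Icc.1 hk).2 ht,
      integral_const_mul]
  have hi : ∀ k ∈ Finset.Icc 1 n,
      IntegrableOn (fun s => a k * (iteratedDeriv k z s * wrightG β s t)) (Ioi 0) :=
    fun k hk => (hint k (Finset.mem_Icc.1 hk).2).const_mul _
  rw [Finset.sum_congr rfl hsum, hy t ht, hFβ t ht, ← integral_const_mul,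
    ← integral_finsetSum _ hi, ← integral_add (integrable_finsetSum _ hi) (hint0.const_mul _)]
  refine setIntegral_congr_fun measurableSet_Ioi fun s hs => ?_
  simp only [← hode s (le_of_lt hs), add_mul, Finset.sum_mul]
  simp only [mul_assoc]
end

section
/- Let 0 < β < 1, let a_2 ≠ 0, a_1, a_0 be real, and suppose the characteristic polynomial a_2 r^2 + a_1 r + a_0 has two distinct real roots r_1 ≠ r_2. Then for any real constants c_1, c_2 the function y(t) = c_1 E_β(r_1 t^β) + c_2 E_β(r_2 t^β) = ∑_{n=0}^∞ (c_1 r_1^n + c_2 r_2^n) t^{nβ} / Γ(nβ+1) satisfies a_2 (D_c^β)^2 y(t) + a_1 D_c^β y(t) + a_0 y(t) = 0 for all t > 0. -/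
open MeasureTheory Real Set Filter

/-- Exponential lower bound for the Gamma function, from restricting its integral to `(A, ∞)`. -/
theorem rpow_mul_exp_neg_le_Gamma_add_one {A x : ℝ} (hA : 0 ≤ A) (hx : 0 ≤ x) :
    A ^ x * Real.exp (-A) ≤ Real.Gamma (x + 1) := by
  have hint := Real.GammaIntegral_convergent (s := x + 1) (by linarith)
  have hsub : Ioi A ⊆ Ioi (0 : ℝ) := Ioi_subset_Ioi hA
  rw [Real.Gamma_eq_integral (by linarith), ← integral_exp_neg_Ioi, ← integral_const_mul]
  calc ∫ u in Ioi A, A ^ x * Real.exp (-u)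
      ≤ ∫ u in Ioi A, Real.exp (-u) * u ^ (x + 1 - 1) := by
        refine setIntegral_mono_on ((integrableOn_exp_neg_Ioi A).const_mul _)
          (hint.mono_set hsub) measurableSet_Ioi fun u hu => ?_
        rw [add_sub_cancel_right, mul_comm]
        gcongr
        exact (mem_Ioi.1 hu).le
    _ ≤ ∫ u in Ioi (0 : ℝ), Real.exp (-u) * u ^ (x + 1 - 1) := by
        refine setIntegral_mono_set hint ?_ hsub.eventuallyLE
        filter_upwards [ae_restrict_mem measurableSet_Ioi] with u hu
        have : 0 < u := hu
        simp only [Pi.zero_apply]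
        positivity

theorem summable_pow_div_Gamma {β : ℝ} (hβ : 0 < β) (R : ℝ) :
    Summable fun n : ℕ => R ^ n / Real.Gamma ((n : ℝ) * β + 1) := by
  set S : ℝ := 2 * (|R| + 1) with hS
  have hS0 : 0 < S := by positivity
  set A : ℝ := S ^ (1 / β) with hA
  have hA0 : 0 < A := rpow_pos_of_pos hS0 _
  have hAn (n : ℕ) : A ^ ((n : ℝ) * β) = S ^ n := by
    rw [hA, ← rpow_mul hS0.le, show 1 / β * ((n : ℝ) * β) = n by field_simp, rpow_natCast]
  refine Summable.of_norm_bounded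
    (summable_geometric_two.mul_left (Real.exp A)) fun n => ?_
  have hG := rpow_mul_exp_neg_le_Gamma_add_one hA0.le (by positivity : 0 ≤ (n : ℝ) * β)
  have hGpos : 0 < Real.Gamma ((n : ℝ) * β + 1) := Real.Gamma_pos_of_pos (by positivity)
  rw [hAn] at hG
  rw [norm_div, norm_pow, Real.norm_eq_abs, Real.norm_of_nonneg hGpos.le, div_le_iff₀ hGpos]
  calc |R| ^ n ≤ (|R| + 1) ^ n := by gcongr; linarith
    _ = Real.exp A * (1 / 2) ^ n * (S ^ n * Real.exp (-A)) := by
        rw [Real.exp_neg, hS, mul_pow, one_div, inv_pow]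
        field_simp
    _ ≤ _ := by gcongr

theorem summable_mul_pow_div_Gamma {β : ℝ} (hβ : 0 < β) {b : ℕ → ℝ} {C R : ℝ}
    (hb : ∀ n, |b n| ≤ C * R ^ n) (z : ℝ) :
    Summable fun n : ℕ => b n * z ^ n / Real.Gamma ((n : ℝ) * β + 1) := by
  refine Summable.of_norm_bounded
    ((summable_pow_div_Gamma hβ (R * |z|)).mul_left C) fun n => ?_
  have hGpos : 0 < Real.Gamma ((n : ℝ) * β + 1) := Real.Gamma_pos_of_pos (by positivity)
  rw [norm_div, norm_mul, norm_pow, Real.norm_eq_abs, Real.norm_eq_abs,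
    Real.norm_of_nonneg hGpos.le, ← mul_div_assoc, mul_pow, ← mul_assoc]
  gcongr
  exact hb n

theorem rpow_natCast_mul_comm {t : ℝ} (ht : 0 ≤ t) (n : ℕ) (β : ℝ) :
    t ^ ((n : ℝ) * β) = (t ^ β) ^ n := by
  rw [mul_comm, rpow_mul ht, rpow_natCast]

theorem hasDerivAt_tsum_pow_div_Gamma {β : ℝ} (hβ : 0 < β) {b : ℕ → ℝ} {C R : ℝ}
    (hb : ∀ n, |b n| ≤ C * R ^ n) (z : ℝ) :
    HasDerivAt (fun z => ∑' n : ℕ, b n * z ^ n / Real.Gamma ((n : ℝ) * β + 1))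
      (∑' n : ℕ, b (n + 1) * ((n + 1 : ℕ) * z ^ n) /
        Real.Gamma (((n + 1 : ℕ) : ℝ) * β + 1)) z := by
  set M : ℝ := |z| + 1 with hM
  have hM1 : 1 ≤ M := by simp [hM]
  have hu : Summable fun n : ℕ =>
      |b n| * (2 * M) ^ n / Real.Gamma ((n : ℝ) * β + 1) :=
    summable_mul_pow_div_Gamma (b := fun n => |b n|) (C := C) (R := R) hβ (by simpa using hb) _
  have hbound (n : ℕ) (w : ℝ) (hw : w ∈ Metric.ball (0 : ℝ) M) :
      ‖b n * (n * w ^ (n - 1)) / Real.Gamma ((n : ℝ) * β + 1)‖ ≤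
        |b n| * (2 * M) ^ n / Real.Gamma ((n : ℝ) * β + 1) := by
    have hGpos : 0 < Real.Gamma ((n : ℝ) * β + 1) := Real.Gamma_pos_of_pos (by positivity)
    have hwM : |w| ≤ M := by simpa using (mem_ball_zero_iff.1 hw).le
    rw [norm_div, norm_mul, norm_mul, norm_pow, Real.norm_eq_abs, Real.norm_eq_abs,
      Real.norm_eq_abs, Real.norm_of_nonneg hGpos.le, Nat.abs_cast, mul_pow]
    have h1 : (n : ℝ) ≤ 2 ^ n := by exact_mod_cast (Nat.lt_two_pow_self).le
    have h2 : |w| ^ (n - 1) ≤ M ^ n :=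
      (pow_le_pow_left₀ (abs_nonneg w) hwM _).trans (pow_le_pow_right₀ hM1 (Nat.sub_le n 1))
    gcongr
  have hz : z ∈ Metric.ball (0 : ℝ) M := by simp [hM]
  have key := hasDerivAt_tsum_of_isPreconnected hu Metric.isOpen_ball
    (convex_ball (0 : ℝ) M).isPreconnected
    (g := fun n w => b n * w ^ n / Real.Gamma ((n : ℝ) * β + 1))
    (fun n w _ => ((hasDerivAt_pow n w).const_mul (b n)).div_const _) hbound hz
    (summable_mul_pow_div_Gamma hβ hb z) hz
  rw [(Summable.of_norm_bounded hu fun n => hbound n z hz).tsum_eq_zero_add] at key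
  simpa using key

/-- Termwise differentiation of `∑ bₙ t^{nβ} / Γ(nβ + 1)`. -/
theorem hasDerivAt_of_eq_tsum_rpow_div_Gamma {β : ℝ} (hβ : 0 < β) {b : ℕ → ℝ} {C R : ℝ}
    (hb : ∀ n, |b n| ≤ C * R ^ n) {f : ℝ → ℝ}
    (hf : ∀ t, 0 < t → f t = ∑' n : ℕ, b n * t ^ ((n : ℝ) * β) / Real.Gamma ((n : ℝ) * β + 1))
    {t : ℝ} (ht : 0 < t) :
    HasDerivAt f
      (∑' n : ℕ, b (n + 1) * (t ^ (((n : ℝ) + 1) * β - 1) / Real.Gamma (((n : ℝ) + 1) * β))) t := by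
  have h1 := (hasDerivAt_tsum_pow_div_Gamma hβ hb (t ^ β)).comp t
    (Real.hasDerivAt_rpow_const (p := β) (Or.inl ht.ne'))
  rw [← tsum_mul_right] at h1
  refine (h1.congr_of_eventuallyEq (f₁ := f) ?_).congr_deriv ?_
  · filter_upwards [eventually_gt_nhds ht] with s hs
    simp only [hf s hs, Function.comp, rpow_natCast_mul_comm hs.le]
  refine tsum_congr fun n => ?_
  have hpos : 0 < ((n : ℝ) + 1) * β := by positivity
  have hG := (Real.Gamma_pos_of_pos hpos).ne'
  push_cast
  rw [Real.Gamma_add_one hpos.ne', ← rpow_natCast_mul_comm ht.le,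
    show ((n : ℝ) + 1) * β - 1 = n * β + (β - 1) by ring, rpow_add ht]
  field_simp

/-- The scaled real Beta integral. -/
theorem integral_rpow_mul_sub_rpow {s r a : ℝ} (hs : 0 < s) (hr : 0 < r) (ha : 0 < a) :
    ∫ x in (0 : ℝ)..a, x ^ (s - 1) * (a - x) ^ (r - 1) =
      a ^ (s + r - 1) * (Real.Gamma s * Real.Gamma r / Real.Gamma (s + r)) := by
  have h := Complex.betaIntegral_scaled s r ha
  rw [Complex.betaIntegral_eq_Gamma_mul_div _ _ (by simpa) (by simpa)] at h
  apply Complex.ofReal_injective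
  rw [← intervalIntegral.integral_ofReal]
  push_cast [Complex.ofReal_cpow ha.le, ← Complex.Gamma_ofReal]
  rw [← h]
  refine intervalIntegral.integral_congr fun x hx => ?_
  rw [uIcc_of_le ha.le] at hx
  rw [Complex.ofReal_cpow hx.1, Complex.ofReal_cpow (sub_nonneg.2 hx.2)]
  push_cast
  rfl

theorem intervalIntegrable_rpow_mul_sub_rpow {s r a : ℝ} (hs : 0 < s) (hr : 0 < r) (ha : 0 < a) :
    IntervalIntegrable (fun x => x ^ (s - 1) * (a - x) ^ (r - 1)) volume 0 a := by
  by_contra hcon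
  have h := integral_rpow_mul_sub_rpow hs hr ha
  rw [intervalIntegral.integral_undef hcon] at h
  have h1 := Real.Gamma_pos_of_pos hs
  have h2 := Real.Gamma_pos_of_pos hr
  have h3 := Real.Gamma_pos_of_pos (add_pos hs hr)
  have : 0 < a ^ (s + r - 1) * (Real.Gamma s * Real.Gamma r / Real.Gamma (s + r)) := by positivity
  linarith

/-- The Caputo derivative shifts the coefficients of `∑ bₙ t^{nβ} / Γ(nβ + 1)`. -/
theorem caputo_of_eq_tsum_rpow_div_Gamma {β : ℝ} (hβ0 : 0 < β) (hβ1 : β < 1) {b : ℕ → ℝ}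
    {C R : ℝ} (hb : ∀ n, |b n| ≤ C * R ^ n) {f : ℝ → ℝ}
    (hf : ∀ t, 0 < t → f t = ∑' n : ℕ, b n * t ^ ((n : ℝ) * β) / Real.Gamma ((n : ℝ) * β + 1))
    {t : ℝ} (ht : 0 < t) :
    caputo β f t =
      ∑' n : ℕ, b (n + 1) * t ^ ((n : ℝ) * β) / Real.Gamma ((n : ℝ) * β + 1) := by
  have h1β : 0 < 1 - β := by linarith
  have hG1 := Real.Gamma_pos_of_pos h1β
  have hpos (n : ℕ) : 0 < ((n : ℝ) + 1) * β := by positivity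
  have hG (n : ℕ) := Real.Gamma_pos_of_pos (hpos n)
  set k : ℕ → ℝ → ℝ := fun n x =>
    x ^ (((n : ℝ) + 1) * β - 1) * (t - x) ^ (1 - β - 1) with hk
  have hk_int (n : ℕ) : IntegrableOn (k n) (Ioc 0 t) :=
    (intervalIntegrable_iff_integrableOn_Ioc_of_le ht.le).1
      (intervalIntegrable_rpow_mul_sub_rpow (hpos n) h1β ht)
  have hk_eq (n : ℕ) : ∫ x in Ioc 0 t, k n x = t ^ ((n : ℝ) * β) *
      (Real.Gamma (((n : ℝ) + 1) * β) * Real.Gamma (1 - β) / Real.Gamma ((n : ℝ) * β + 1)) := by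
    rw [← intervalIntegral.integral_of_le ht.le, integral_rpow_mul_sub_rpow (hpos n) h1β ht]
    congr 3 <;> ring
  set F : ℕ → ℝ → ℝ := fun n x => b (n + 1) / Real.Gamma (((n : ℝ) + 1) * β) * k n x with hF
  have hF_eq (n : ℕ) : ∫ x in Ioc 0 t, F n x = Real.Gamma (1 - β) *
      (b (n + 1) * t ^ ((n : ℝ) * β) / Real.Gamma ((n : ℝ) * β + 1)) := by
    simp only [hF, integral_const_mul, hk_eq]
    have := (hG n).ne'
    field_simp
  have hF_norm (n : ℕ) : ∫ x in Ioc 0 t, ‖F n x‖ = Real.Gamma (1 - β) *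
      (|b (n + 1)| * (t ^ β) ^ n / Real.Gamma ((n : ℝ) * β + 1)) := by
    have : ∀ x ∈ Ioc 0 t, ‖F n x‖ = |b (n + 1)| / Real.Gamma (((n : ℝ) + 1) * β) * k n x := by
      intro x hx
      have hkx : 0 ≤ k n x :=
        mul_nonneg (rpow_nonneg hx.1.le _) (rpow_nonneg (sub_nonneg.2 hx.2) _)
      simp only [hF, norm_mul, norm_div, Real.norm_eq_abs, abs_of_pos (hG n), abs_of_nonneg hkx]
    rw [setIntegral_congr_fun measurableSet_Ioc this, integral_const_mul, hk_eq,
      rpow_natCast_mul_comm ht.le]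
    have := (hG n).ne'
    field_simp
  have hb' (n : ℕ) : |(|b (n + 1)|)| ≤ C * R * R ^ n := by
    rw [abs_abs, mul_assoc, ← pow_succ']
    exact hb (n + 1)
  have hsum := hasSum_integral_of_summable_integral_norm (μ := volume.restrict (Ioc 0 t))
    (F := F) (fun n => (hk_int n).const_mul _) (by
      simp only [hF_norm]
      exact (summable_mul_pow_div_Gamma hβ0 hb' (t ^ β)).mul_left _)
  have hcongr : ∀ x ∈ Ioc 0 t, (t - x) ^ (-β) * deriv f x = ∑' n, F n x := by
    intro x hx
    rw [(hasDerivAt_of_eq_tsum_rpow_div_Gamma hβ0 hb hf hx.1).deriv, ← tsum_mul_left]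
    refine tsum_congr fun n => ?_
    simp only [hF, hk, show 1 - β - 1 = -β by ring]
    ring
  rw [caputo, intervalIntegral.integral_of_le ht.le,
    setIntegral_congr_fun measurableSet_Ioc hcongr, ← hsum.tsum_eq]
  simp only [hF_eq]
  rw [tsum_mul_left, ← mul_assoc, one_div, inv_mul_cancel₀ hG1.ne', one_mul]

/-- Distinct real roots case. If `r₁ ≠ r₂` are roots of
`a₂ r² + a₁ r + a₀`, then `y(t) = ∑ (c₁ r₁ⁿ + c₂ r₂ⁿ) t^{nβ}/Γ(nβ+1)`
(equivalently `c₁ E_β(r₁ t^β) + c₂ E_β(r₂ t^β)`) satisfies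
`a₂ (D_c^β)² y + a₁ D_c^β y + a₀ y = 0` on `(0,∞)`. -/
theorem fractional_second_order_distinct_real_roots (β : ℝ) (hβ0 : 0 < β) (hβ1 : β < 1)
    (a2 a1 a0 r1 r2 c1 c2 : ℝ) (ha2 : a2 ≠ 0)
    (hr1 : a2 * r1 ^ 2 + a1 * r1 + a0 = 0) (hr2 : a2 * r2 ^ 2 + a1 * r2 + a0 = 0)
    (hne : r1 ≠ r2) (y : ℝ → ℝ)
    (hy : ∀ t : ℝ, y t = ∑' n : ℕ,
      (c1 * r1 ^ n + c2 * r2 ^ n) * t ^ ((n : ℝ) * β) / Real.Gamma ((n : ℝ) * β + 1)) :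
    ∀ t : ℝ, 0 < t →
      y t = c1 * mittagLeffler β 1 (r1 * t ^ β) + c2 * mittagLeffler β 1 (r2 * t ^ β) ∧
      a2 * (caputo β)^[2] y t + a1 * caputo β y t + a0 * y t = 0 := by
  intro t ht
  constructor
  · rw [hy, mittagLeffler, mittagLeffler, ← tsum_mul_left, ← tsum_mul_left, ← Summable.tsum_add]
    · refine tsum_congr fun n => ?_
      rw [rpow_natCast_mul_comm ht.le, mul_pow, mul_pow, mul_comm β]
      ring
    · simpa only [mul_comm β] using (summable_pow_div_Gamma hβ0 (r1 * t ^ β)).mul_left c1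
    · simpa only [mul_comm β] using (summable_pow_div_Gamma hβ0 (r2 * t ^ β)).mul_left c2
  · set b : ℕ → ℝ := fun n => c1 * r1 ^ n + c2 * r2 ^ n with hb_def
    set C : ℝ := |c1| + |c2|
    set R : ℝ := max |r1| |r2|
    have hb (n : ℕ) : |b n| ≤ C * R ^ n := by
      calc |b n| ≤ |c1| * |r1| ^ n + |c2| * |r2| ^ n := by
            simpa only [abs_mul, abs_pow] using abs_add_le (c1 * r1 ^ n) (c2 * r2 ^ n)
        _ ≤ |c1| * R ^ n + |c2| * R ^ n := by
            gcongr
            exacts [le_max_left _ _, le_max_right _ _]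
        _ = C * R ^ n := by ring
    have hb1 (n : ℕ) : |b (n + 1)| ≤ C * R * R ^ n := by
      rw [mul_assoc, ← pow_succ']
      exact hb (n + 1)
    have hb2 (n : ℕ) : |b (n + 2)| ≤ C * R * R * R ^ n := by
      rw [mul_assoc (C * R), ← pow_succ']
      exact hb1 (n + 1)
    have hD1 {s : ℝ} (hs : 0 < s) := caputo_of_eq_tsum_rpow_div_Gamma hβ0 hβ1 hb (fun s _ => hy s) hs
    have hD2 := caputo_of_eq_tsum_rpow_div_Gamma (b := fun n => b (n + 1)) hβ0 hβ1 hb1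
      (fun s hs => hD1 hs) ht
    have hS {b' : ℕ → ℝ} {C' : ℝ} (h : ∀ n, |b' n| ≤ C' * R ^ n) := by
      simpa only [← rpow_natCast_mul_comm ht.le] using summable_mul_pow_div_Gamma hβ0 h (t ^ β)
    change a2 * caputo β (caputo β y) t + _ + _ = 0
    rw [hD2, hD1 ht, hy t, ← tsum_mul_left, ← tsum_mul_left, ← tsum_mul_left,
      ← ((hS hb2).mul_left a2).tsum_add ((hS hb1).mul_left a1),
      ← (((hS hb2).mul_left a2).add ((hS hb1).mul_left a1)).tsum_add ((hS hb).mul_left a0)]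
    refine (tsum_congr fun n => ?_).trans tsum_zero
    have hrec : a2 * b (n + 2) + a1 * b (n + 1) + a0 * b n = 0 := by
      simp only [hb_def]
      linear_combination c1 * r1 ^ n * hr1 + c2 * r2 ^ n * hr2
    linear_combination
      t ^ ((n : ℝ) * β) / Real.Gamma ((n : ℝ) * β + 1) * hrec
end

section
/- Let 0 < β < 1, let a_2 ≠ 0, a_1, a_0 be real, and suppose the characteristic polynomial a_2 r^2 + a_1 r + a_0 has a repeated real root r. Then for any real constants c_1, c_2 the function y(t) = ∑_{n=0}^∞ (c_2 r^n + c_1 n r^{n−1}) t^{nβ} / Γ(nβ+1) (i.e. y(t) = c_2 E_β(r t^β) + c_1 ∂_r E_β(r t^β)) satisfies a_2 (D_c^β)^2 y(t) + a_1 D_c^β y(t) + a_0 y(t) = 0 for all t > 0. -/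
open MeasureTheory Real Set Filter

theorem rpow_mul_exp_neg_le_Gamma {x M : ℝ} (hx : 0 ≤ x) (hM : 0 < M) :
    M ^ x * Real.exp (-M) ≤ Real.Gamma (x + 1) := by
  rw [Real.Gamma_eq_integral (by linarith), add_sub_cancel_right]
  have hint := Real.GammaIntegral_convergent (s := x + 1) (by linarith)
  rw [add_sub_cancel_right] at hint
  calc M ^ x * Real.exp (-M) = ∫ s in Ioi M, M ^ x * Real.exp (-s) := by
        rw [integral_const_mul, integral_exp_neg_Ioi]
    _ ≤ ∫ s in Ioi M, Real.exp (-s) * s ^ x := by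
        refine setIntegral_mono_on ((integrableOn_exp_neg_Ioi M).const_mul _)
          (hint.mono_set (Ioi_subset_Ioi hM.le)) measurableSet_Ioi fun s hs => ?_
        rw [mul_comm]
        have hs' : M < s := hs
        gcongr
    _ ≤ ∫ s in Ioi 0, Real.exp (-s) * s ^ x := by
        refine setIntegral_mono_set hint ?_ (Ioi_subset_Ioi hM.le).eventuallyLE
        filter_upwards [ae_restrict_mem measurableSet_Ioi] with s hs
        have hs' : 0 < s := hs
        simp only [Pi.zero_apply]
        positivity

theorem summable_abs_mul_pow_div_Gamma {β C R : ℝ} (hβ : 0 < β) (hR : 0 ≤ R) {a : ℕ → ℝ}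
    (ha : ∀ n, |a n| ≤ C * R ^ n) {x : ℝ} (hx : 0 ≤ x) :
    Summable fun n : ℕ => |a n / Real.Gamma ((n : ℝ) * β + 1)| * x ^ n := by
  set K := 2 * R * x + 1 with hK
  have hK0 : 0 < K := by positivity
  set M := K ^ β⁻¹ with hM
  have hM0 : 0 < M := by positivity
  have hMβ : M ^ β = K := by
    rw [hM, ← Real.rpow_mul hK0.le, inv_mul_cancel₀ hβ.ne', Real.rpow_one]
  have hC : 0 ≤ C := by simpa using (abs_nonneg _).trans (ha 0)
  have hq : R * x / K < 1 := by
    rw [div_lt_one hK0, hK]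
    nlinarith [mul_nonneg hR hx]
  refine Summable.of_nonneg_of_le (fun n => by positivity) (fun n => ?_)
    ((summable_geometric_of_lt_one (by positivity) hq).mul_left (C * Real.exp M))
  have hG := rpow_mul_exp_neg_le_Gamma (x := n * β) (by positivity) hM0
  have hpow : M ^ ((n : ℝ) * β) = K ^ n := by
    rw [mul_comm, Real.rpow_mul hM0.le, hMβ, Real.rpow_natCast]
  rw [hpow] at hG
  have hpos : 0 < K ^ n * Real.exp (-M) := by positivity
  rw [abs_div, abs_of_pos (hpos.trans_le hG)]
  calc |a n| / Real.Gamma (n * β + 1) * x ^ n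
      ≤ C * R ^ n / (K ^ n * Real.exp (-M)) * x ^ n := by
        gcongr
        exact ha n
    _ = C * Real.exp M * (R * x / K) ^ n := by
        rw [Real.exp_neg, div_pow, mul_pow]
        field_simp

theorem summable_abs_mul_natCast_mul_pow {b : ℕ → ℝ}
    (hb : ∀ x, 0 ≤ x → Summable fun n => |b n| * x ^ n) {x : ℝ} (hx : 1 ≤ x) :
    Summable fun n : ℕ => |b n| * (n * x ^ (n - 1)) := by
  refine Summable.of_nonneg_of_le (fun n => by positivity) (fun n => ?_)
    (hb (2 * x) (by positivity))
  rw [mul_pow]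
  have h : (n : ℝ) ≤ 2 ^ n := by exact_mod_cast n.lt_two_pow_self.le
  gcongr
  omega

theorem summable_mul_natCast_mul_pow {b : ℕ → ℝ}
    (hb : ∀ x, 0 ≤ x → Summable fun n => |b n| * x ^ n) (z : ℝ) :
    Summable fun n : ℕ => b n * (n * z ^ (n - 1)) := by
  refine Summable.of_norm_bounded (summable_abs_mul_natCast_mul_pow hb
    (x := |z| + 1) (by linarith [abs_nonneg z])) fun n => ?_
  rw [Real.norm_eq_abs, abs_mul, abs_mul, Nat.abs_cast, abs_pow]
  gcongr
  linarith

theorem hasDerivAt_tsum_mul_pow {b : ℕ → ℝ}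
    (hb : ∀ x, 0 ≤ x → Summable fun n => |b n| * x ^ n) (z : ℝ) :
    HasDerivAt (fun w => ∑' n, b n * w ^ n) (∑' n : ℕ, b n * (n * z ^ (n - 1))) z := by
  have hz : z ∈ Metric.ball (0 : ℝ) (|z| + 1) := by simp
  refine hasDerivAt_tsum_of_isPreconnected
    (summable_abs_mul_natCast_mul_pow hb (x := |z| + 1) (by linarith [abs_nonneg z]))
    Metric.isOpen_ball (convex_ball (0 : ℝ) (|z| + 1)).isPreconnected
    (fun n w _ => (hasDerivAt_pow n w).const_mul (b n)) (fun n w hw => ?_) hz ?_ hz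
  · rw [Real.norm_eq_abs, abs_mul, abs_mul, Nat.abs_cast, abs_pow]
    have : |w| < |z| + 1 := by simpa using hw
    gcongr
  · refine Summable.of_norm_bounded (hb |z| (abs_nonneg z)) fun n => ?_
    rw [Real.norm_eq_abs, abs_mul, abs_pow]

theorem integral_sub_rpow_mul_rpow {s v t : ℝ} (hs : 0 < s) (hv : 0 < v) (ht : 0 < t) :
    ∫ x in (0 : ℝ)..t, (t - x) ^ (v - 1) * x ^ (s - 1) =
      t ^ (s + v - 1) * (Real.Gamma s * Real.Gamma v / Real.Gamma (s + v)) := by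
  have h := Complex.betaIntegral_scaled (s : ℂ) (v : ℂ) ht
  rw [Complex.betaIntegral_eq_Gamma_mul_div _ _ (by simpa) (by simpa)] at h
  apply Complex.ofReal_injective
  rw [← intervalIntegral.integral_ofReal]
  push_cast [← Complex.Gamma_ofReal, Complex.ofReal_cpow ht.le]
  rw [← h]
  refine intervalIntegral.integral_congr fun x hx => ?_
  rw [uIcc_of_le ht.le] at hx
  rw [Complex.ofReal_cpow hx.1, Complex.ofReal_cpow (sub_nonneg.2 hx.2), mul_comm]
  push_cast
  rfl

theorem intervalIntegrable_sub_rpow_mul_rpow {s v t : ℝ} (hs : 0 < s) (hv : 0 < v) (ht : 0 < t) :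
    IntervalIntegrable (fun x => (t - x) ^ (v - 1) * x ^ (s - 1)) volume 0 t := by
  refine intervalIntegral.intervalIntegrable_of_integral_ne_zero ?_
  rw [integral_sub_rpow_mul_rpow hs hv ht]
  have := Real.Gamma_pos_of_pos hs
  have := Real.Gamma_pos_of_pos hv
  have := Real.Gamma_pos_of_pos (add_pos hs hv)
  positivity

/-- The fractional power series `∑ aₙ t^{nβ} / Γ(nβ + 1)`. -/
noncomputable def fractionalSeries (β : ℝ) (a : ℕ → ℝ) (t : ℝ) : ℝ :=
  ∑' n : ℕ, a n * t ^ ((n : ℝ) * β) / Real.Gamma ((n : ℝ) * β + 1)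

theorem rpow_natCast_mul_eq_pow {t : ℝ} (ht : 0 ≤ t) (β : ℝ) (n : ℕ) :
    t ^ ((n : ℝ) * β) = (t ^ β) ^ n := by
  rw [mul_comm, Real.rpow_mul ht, Real.rpow_natCast]

theorem fractionalSeries_eq_tsum_mul_pow {t : ℝ} (ht : 0 ≤ t) (β : ℝ) (a : ℕ → ℝ) :
    fractionalSeries β a t = ∑' n : ℕ, a n / Real.Gamma ((n : ℝ) * β + 1) * (t ^ β) ^ n := by
  refine tsum_congr fun n => ?_
  rw [rpow_natCast_mul_eq_pow ht, div_mul_eq_mul_div]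

theorem summable_fractionalSeries {β C R : ℝ} (hβ : 0 < β) (hR : 0 ≤ R) {a : ℕ → ℝ}
    (ha : ∀ n, |a n| ≤ C * R ^ n) {t : ℝ} (ht : 0 ≤ t) :
    Summable fun n : ℕ => a n * t ^ ((n : ℝ) * β) / Real.Gamma ((n : ℝ) * β + 1) := by
  refine Summable.of_norm_bounded (summable_abs_mul_pow_div_Gamma hβ hR ha
    (x := t ^ β) (by positivity)) fun n => ?_
  rw [rpow_natCast_mul_eq_pow ht, mul_div_right_comm, Real.norm_eq_abs, abs_mul,
    abs_of_nonneg (a := (t ^ β) ^ n) (by positivity)]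

theorem hasDerivAt_fractionalSeries {β C R : ℝ} (hβ : 0 < β) (hR : 0 ≤ R) {a : ℕ → ℝ}
    (ha : ∀ n, |a n| ≤ C * R ^ n) {t : ℝ} (ht : 0 < t) :
    HasDerivAt (fractionalSeries β a) (∑' n : ℕ,
      a (n + 1) / Real.Gamma (((n : ℝ) + 1) * β) * t ^ (((n : ℝ) + 1) * β - 1)) t := by
  have hb : ∀ x, 0 ≤ x →
      Summable fun n : ℕ => |a n / Real.Gamma ((n : ℝ) * β + 1)| * x ^ n :=
    fun x hx => summable_abs_mul_pow_div_Gamma hβ hR ha hx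
  have h := (hasDerivAt_tsum_mul_pow hb (t ^ β)).comp t
    (Real.hasDerivAt_rpow_const (p := β) (Or.inl ht.ne'))
  rw [(summable_mul_natCast_mul_pow hb (t ^ β)).tsum_eq_zero_add] at h
  simp only [Nat.cast_zero, zero_mul, mul_zero, zero_add, ← tsum_mul_right] at h
  refine (h.congr_of_eventuallyEq ?_).congr_deriv (tsum_congr fun n => ?_)
  · filter_upwards [lt_mem_nhds ht] with s hs
    exact fractionalSeries_eq_tsum_mul_pow hs.le β a
  · have hn : 0 < ((n : ℝ) + 1) * β := by positivity
    have hG := Real.Gamma_pos_of_pos hn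
    have hexp : t ^ (((n : ℝ) + 1) * β - 1) = (t ^ β) ^ n * t ^ (β - 1) := by
      rw [← rpow_natCast_mul_eq_pow ht.le, ← Real.rpow_add ht]
      ring_nf
    rw [hexp]
    push_cast
    rw [Real.Gamma_add_one hn.ne']
    field_simp

theorem caputo_eq_fractionalSeries_succ {β C R : ℝ} (hβ0 : 0 < β) (hβ1 : β < 1) (hR : 0 ≤ R)
    {a : ℕ → ℝ} (ha : ∀ n, |a n| ≤ C * R ^ n) {h : ℝ → ℝ}
    (hh : EqOn h (fractionalSeries β a) (Ioi 0)) {t : ℝ} (ht : 0 < t) :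
    caputo β h t = fractionalSeries β (fun n => a (n + 1)) t := by
  have hsucc : ∀ n, |a (n + 1)| ≤ C * R * R ^ n := fun n => (ha (n + 1)).trans_eq (by ring)
  have hv : 0 < 1 - β := by linarith
  have hGv := Real.Gamma_pos_of_pos hv
  have hderiv : ∀ τ, 0 < τ → deriv h τ = ∑' n : ℕ,
      a (n + 1) / Real.Gamma (((n : ℝ) + 1) * β) * τ ^ (((n : ℝ) + 1) * β - 1) := by
    intro τ hτ
    refine ((hasDerivAt_fractionalSeries hβ0 hR ha hτ).congr_of_eventuallyEq ?_).deriv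
    exact hh.eventuallyEq_of_mem (Ioi_mem_nhds hτ)
  set K : ℕ → ℝ → ℝ := fun n τ =>
    (t - τ) ^ ((1 - β) - 1) * τ ^ (((n : ℝ) + 1) * β - 1) with hK
  set c : ℕ → ℝ := fun n => a (n + 1) / Real.Gamma (((n : ℝ) + 1) * β) with hc
  have hs : ∀ n : ℕ, 0 < ((n : ℝ) + 1) * β := fun n => by positivity
  have hKint : ∀ n, ∫ τ in Ioc 0 t, K n τ = Real.Gamma (1 - β) * (Real.Gamma (((n : ℝ) + 1) * β) *
      (t ^ ((n : ℝ) * β) / Real.Gamma ((n : ℝ) * β + 1))) := by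
    intro n
    rw [← intervalIntegral.integral_of_le ht.le, hK, integral_sub_rpow_mul_rpow (hs n) hv ht]
    rw [show ((n : ℝ) + 1) * β + (1 - β) = n * β + 1 by ring, add_sub_cancel_right]
    ring
  have hmain := hasSum_integral_of_summable_integral_norm (μ := volume.restrict (Ioc 0 t))
    (F := fun n τ => c n * K n τ)
    (fun n => (((intervalIntegrable_iff_integrableOn_Ioc_of_le ht.le).1
      (intervalIntegrable_sub_rpow_mul_rpow (hs n) hv ht)).const_mul (c n)))
    (by
      refine ((summable_fractionalSeries hβ0 hR hsucc ht.le).abs.mul_left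
        (Real.Gamma (1 - β))).congr fun n => ?_
      have hnorm : ∫ τ in Ioc 0 t, ‖c n * K n τ‖ = |c n| * ∫ τ in Ioc 0 t, K n τ := by
        rw [← integral_const_mul]
        refine setIntegral_congr_fun measurableSet_Ioc fun τ hτ => ?_
        have : 0 ≤ K n τ :=
          mul_nonneg (Real.rpow_nonneg (sub_nonneg.2 hτ.2) _) (Real.rpow_nonneg hτ.1.le _)
        simp only [norm_mul, Real.norm_eq_abs, abs_of_nonneg this]
      have hG := Real.Gamma_pos_of_pos (hs n)
      have hG' := Real.Gamma_pos_of_pos (s := (n : ℝ) * β + 1) (by positivity)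
      rw [hnorm, hKint, show |c n| = _ from abs_div _ _, abs_of_pos hG, abs_div, abs_mul, abs_of_pos hG',
        abs_of_nonneg (a := t ^ ((n : ℝ) * β)) (by positivity)]
      field_simp)
  have hintegral : ∫ τ in (0 : ℝ)..t, (t - τ) ^ (-β) * deriv h τ =
      ∫ τ in Ioc 0 t, ∑' n, c n * K n τ := by
    rw [intervalIntegral.integral_of_le ht.le]
    refine setIntegral_congr_fun measurableSet_Ioc fun τ hτ => ?_
    rw [hderiv τ hτ.1, ← tsum_mul_left]
    refine tsum_congr fun n => ?_
    simp only [hK, hc]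
    rw [show (1 - β) - 1 = -β by ring]
    ring
  rw [caputo, hintegral, ← hmain.tsum_eq, ← tsum_mul_left, fractionalSeries]
  refine tsum_congr fun n => ?_
  have hG := Real.Gamma_pos_of_pos (hs n)
  rw [integral_const_mul, hKint]
  simp only [hc]
  field_simp

theorem abs_repeatedRoot_coeff_le (r c1 c2 : ℝ) (n : ℕ) :
    |c2 * r ^ n + c1 * (n : ℝ) * r ^ (n - 1)| ≤ (|c2| + |c1|) * (2 * (|r| + 1)) ^ n := by
  have hr : 1 ≤ |r| + 1 := by linarith [abs_nonneg r]
  have h1 : |r| ^ n ≤ (2 * (|r| + 1)) ^ n := by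
    gcongr
    linarith [abs_nonneg r]
  have h2 : (n : ℝ) * |r| ^ (n - 1) ≤ (2 * (|r| + 1)) ^ n := by
    rw [mul_pow]
    have h : (n : ℝ) ≤ 2 ^ n := by exact_mod_cast n.lt_two_pow_self.le
    have h' : |r| ^ (n - 1) ≤ (|r| + 1) ^ n :=
      (pow_le_pow_left₀ (abs_nonneg r) (by linarith) _).trans
        (pow_le_pow_right₀ hr (Nat.sub_le n 1))
    gcongr
  refine (abs_add_le _ _).trans ?_
  rw [abs_mul, abs_mul, abs_mul, Nat.abs_cast, abs_pow, abs_pow, add_mul, mul_assoc]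
  gcongr

theorem repeatedRoot_coeff_recurrence {a2 a1 a0 r : ℝ} (hroot : a2 * r ^ 2 + a1 * r + a0 = 0)
    (hrep : 2 * a2 * r + a1 = 0) (c1 c2 : ℝ) (n : ℕ) :
    a2 * (c2 * r ^ (n + 2) + c1 * ((n + 2 : ℕ) : ℝ) * r ^ (n + 2 - 1))
      + a1 * (c2 * r ^ (n + 1) + c1 * ((n + 1 : ℕ) : ℝ) * r ^ (n + 1 - 1))
      + a0 * (c2 * r ^ n + c1 * (n : ℝ) * r ^ (n - 1)) = 0 := by
  cases n with
  | zero =>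
    simp
    linear_combination c2 * hroot + c1 * hrep
  | succ m =>
    simp only [Nat.add_sub_cancel, show m + 1 + 2 - 1 = m + 2 by omega]
    push_cast
    linear_combination (c2 * r ^ (m + 1) + c1 * (m + 1) * r ^ m) * hroot
      + c1 * r ^ (m + 1) * hrep

theorem mittagLeffler_one_eq_tsum (β ρ z : ℝ) :
    mittagLeffler β 1 (ρ * z) =
      ∑' n : ℕ, z ^ n / Real.Gamma ((n : ℝ) * β + 1) * ρ ^ n := by
  refine tsum_congr fun n => ?_
  rw [mul_pow, mul_comm β]
  ring

/-- Repeated real root case. If `r` is a repeated root of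
`a₂ r² + a₁ r + a₀`, then `y(t) = ∑ (c₂ rⁿ + c₁ n r^{n−1}) t^{nβ}/Γ(nβ+1)`
(i.e. `c₂ E_β(r t^β) + c₁ ∂_r E_β(r t^β)`) satisfies
`a₂ (D_c^β)² y + a₁ D_c^β y + a₀ y = 0` on `(0,∞)`. -/
theorem fractional_second_order_repeated_root (β : ℝ) (hβ0 : 0 < β) (hβ1 : β < 1)
    (a2 a1 a0 r c1 c2 : ℝ) (ha2 : a2 ≠ 0)
    (hroot : a2 * r ^ 2 + a1 * r + a0 = 0) (hrep : 2 * a2 * r + a1 = 0)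
    (y : ℝ → ℝ)
    (hy : ∀ t : ℝ, y t = ∑' n : ℕ,
      (c2 * r ^ n + c1 * (n : ℝ) * r ^ (n - 1)) * t ^ ((n : ℝ) * β)
        / Real.Gamma ((n : ℝ) * β + 1)) :
    ∀ t : ℝ, 0 < t →
      y t = c2 * mittagLeffler β 1 (r * t ^ β)
          + c1 * deriv (fun ρ => mittagLeffler β 1 (ρ * t ^ β)) r ∧
      a2 * (caputo β)^[2] y t + a1 * caputo β y t + a0 * y t = 0 := by
  intro t ht
  set a : ℕ → ℝ := fun n => c2 * r ^ n + c1 * (n : ℝ) * r ^ (n - 1) with ha_def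
  set R := 2 * (|r| + 1) with hR_def
  have hR : 0 ≤ R := by positivity
  have ha : ∀ n, |a n| ≤ (|c2| + |c1|) * R ^ n := abs_repeatedRoot_coeff_le r c1 c2
  have ha1 : ∀ n, |a (n + 1)| ≤ (|c2| + |c1|) * R * R ^ n :=
    fun n => (ha (n + 1)).trans_eq (by ring)
  have ha2' : ∀ n, |a (n + 2)| ≤ (|c2| + |c1|) * R ^ 2 * R ^ n :=
    fun n => (ha (n + 2)).trans_eq (by ring)
  have hy' : y = fractionalSeries β a := funext hy
  have hone : ∀ s, 0 < s → caputo β y s = fractionalSeries β (fun n => a (n + 1)) s :=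
    fun s hs => caputo_eq_fractionalSeries_succ hβ0 hβ1 hR ha (fun x _ => by rw [hy']) hs
  have htwo : (caputo β)^[2] y t = fractionalSeries β (fun n => a (n + 2)) t :=
    caputo_eq_fractionalSeries_succ hβ0 hβ1 hR ha1 (fun s hs => hone s hs) ht
  constructor
  · have hz : 0 ≤ t ^ β := by positivity
    have hb : ∀ x, 0 ≤ x →
        Summable fun n : ℕ => |(t ^ β) ^ n / Real.Gamma ((n : ℝ) * β + 1)| * x ^ n :=
      fun x hx => summable_abs_mul_pow_div_Gamma (C := 1) hβ0 hz
        (fun n => by rw [one_mul, abs_of_nonneg (by positivity)]) hx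
    have hd := (hasDerivAt_tsum_mul_pow hb r).deriv
    have hsum : Summable fun n : ℕ =>
        (t ^ β) ^ n / Real.Gamma ((n : ℝ) * β + 1) * r ^ n := by
      refine Summable.of_norm_bounded (hb |r| (abs_nonneg r)) fun n => ?_
      rw [Real.norm_eq_abs, abs_mul, abs_pow]
    simp only [mittagLeffler_one_eq_tsum]
    rw [hd, ← tsum_mul_left, ← tsum_mul_left, ← (hsum.mul_left c2).tsum_add
      ((summable_mul_natCast_mul_pow hb r).mul_left c1), hy]
    refine tsum_congr fun n => ?_
    rw [rpow_natCast_mul_eq_pow ht.le]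
    ring
  · have s0 := summable_fractionalSeries hβ0 hR ha ht.le
    have s1 := summable_fractionalSeries hβ0 hR ha1 ht.le
    have s2 := summable_fractionalSeries hβ0 hR ha2' ht.le
    rw [htwo, hone t ht, hy']
    simp only [fractionalSeries]
    rw [← tsum_mul_left, ← tsum_mul_left, ← tsum_mul_left,
      ← (s2.mul_left a2).tsum_add (s1.mul_left a1),
      ← ((s2.mul_left a2).add (s1.mul_left a1)).tsum_add (s0.mul_left a0)]
    refine (tsum_congr fun n => ?_).trans tsum_zero
    have hrec : a2 * a (n + 2) + a1 * a (n + 1) + a0 * a n = 0 :=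
      repeatedRoot_coeff_recurrence hroot hrep c1 c2 n
    linear_combination t ^ ((n : ℝ) * β) / Real.Gamma ((n : ℝ) * β + 1) * hrec
end
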